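/- arXiv:1605.00952 — 15 statements merged into one kernel-verified Lean document; each statement's English description precedes it below -/
import Mathlib

section
/- Let H be a real Hilbert space, let h : H → (−∞,+∞] be proper, convex and lower semicontinuous, let γ > 0 and x ∈ dom h, and let p ∈ H satisfy (x − p)/γ ∈ ∂h(p) (i.e., p = prox_{γh}(x)). Let u ∈ H and c ∈ ℝ be such that ⟪z, u⟫ − h(z) ≤ c for every z ∈ H (so c is an upper bound for the Fenchel conjugate value h*(u)). Then ‖p − x‖² ≤ 2γ·( h(x) + c − ⟪x, u⟫ + γ‖u‖²/2 ). -/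
open scoped RealInnerProductSpace
open Filter Topology

attribute [local instance] Classical.propDecidable

/-- Bound on the prox displacement in terms of a bound on the
Fenchel conjugate value.  A proper convex lsc function is modeled by a pair
`(domh, h)` of its (nonempty) domain and its real values there; the extended
function `z ↦ if z ∈ domh then h z else ⊤` is required to be lower
semicontinuous.  `p = prox_{γh}(x)` is encoded by `(x − p)/γ ∈ ∂h(p)`. -/
theorem stmt_0
    {H : Type*} [NormedAddCommGroup H] [InnerProductSpace ℝ H] [CompleteSpace H]
    (domh : Set H) (h : H → ℝ)
    (hdom_ne : domh.Nonempty) (hdom_cvx : Convex ℝ domh)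
    (hcvx : ConvexOn ℝ domh h)
    (hlsc : LowerSemicontinuous fun z : H => if z ∈ domh then (h z : EReal) else ⊤)
    (γ : ℝ) (hγ : 0 < γ) (x : H) (hx : x ∈ domh)
    (p : H) (hp : p ∈ domh)
    (hprox : ∀ w ∈ domh, h p + ⟪w - p, γ⁻¹ • (x - p)⟫ ≤ h w)
    (u : H) (c : ℝ) (hc : ∀ z ∈ domh, ⟪z, u⟫ - h z ≤ c) :
    ‖p - x‖ ^ 2 ≤ 2 * γ * (h x + c - ⟪x, u⟫ + γ * ‖u‖ ^ 2 / 2) := by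
  have hsub := hprox x hx
  rw [real_inner_smul_right, real_inner_self_eq_norm_sq, norm_sub_rev] at hsub
  have hconj := hc p hp
  have hsq : 0 ≤ ‖(p - x) + γ • u‖ ^ 2 := sq_nonneg _
  rw [norm_add_sq_real, real_inner_smul_right, norm_smul, Real.norm_of_nonneg hγ.le,
    inner_sub_left] at hsq
  have hgap : γ⁻¹ * ‖p - x‖ ^ 2 ≤ h x + c - ⟪p, u⟫ := by linarith
  rw [inv_mul_le_iff₀ hγ] at hgap
  nlinarith
end

section
/- Let H be a real Hilbert space, let (x_k) and (x̃_k) be sequences in H, and let x̄ ∈ H be such that x_k ⇀ x̄ and x̃_k ⇀ x̄ weakly. Then the set {x̄} ∪ ⋃_{k ∈ ℕ} [x_k, x̃_k] is compact in the weak topology of H, where [x, y] = { x + t(y − x) : t ∈ [0,1] }. In particular ⋃_{k ∈ ℕ} [x_k, x̄] is weakly compact. -/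
open scoped RealInnerProductSpace
open Filter Topology

/-- In a real topological vector space, the segments joining the terms of two sequences with the
same limit form, together with that limit, a compact set. -/
theorem isCompact_insert_iUnion_segment {E : Type*} [AddCommGroup E] [Module ℝ E]
    [TopologicalSpace E] [ContinuousAdd E] [ContinuousSMul ℝ E] {y z : ℕ → E} {p : E}
    (hy : Tendsto y atTop (𝓝 p)) (hz : Tendsto z atTop (𝓝 p)) :
    IsCompact ({p} ∪ ⋃ k : ℕ, segment ℝ (y k) (z k)) := by
  let Y : C(OnePoint ℕ, E) := OnePoint.continuousMapMkNat y p hy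
  let Z : C(OnePoint ℕ, E) := OnePoint.continuousMapMkNat z p hz
  let F : OnePoint ℕ × ℝ → E := fun q => (1 - q.2) • Y q.1 + q.2 • Z q.1
  have hF : Continuous F := by fun_prop
  have hK : IsCompact (F '' (Set.univ ×ˢ Set.Icc (0 : ℝ) 1)) :=
    (isCompact_univ.prod isCompact_Icc).image hF
  have hp : ∀ t : ℝ, F (OnePoint.infty, t) = p := fun t => by
    change (1 - t) • p + t • p = p
    rw [← add_smul, sub_add_cancel, one_smul]
  convert hK using 1
  ext w
  simp only [Set.mem_union, Set.mem_singleton_iff, Set.mem_iUnion, segment_eq_image,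
    Set.mem_image, Set.mem_prod, Set.mem_univ, true_and, Prod.exists]
  constructor
  · rintro (rfl | ⟨k, t, ht, rfl⟩)
    · exact ⟨OnePoint.infty, 0, by simp, hp 0⟩
    · exact ⟨(k : OnePoint ℕ), t, ht, rfl⟩
  · rintro ⟨k, t, ht, rfl⟩
    induction k using OnePoint.rec with
    | infty => exact Or.inl (hp t)
    | coe k => exact Or.inr ⟨k, t, ht, rfl⟩

/-- In a real Hilbert space, convergence of all inner products implies weak convergence. -/
theorem tendsto_toWeakSpace_of_forall_inner {ι H : Type*} [NormedAddCommGroup H]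
    [InnerProductSpace ℝ H] [CompleteSpace H] {l : Filter ι} {x : ι → H} {p : H}
    (hx : ∀ u : H, Tendsto (fun k => ⟪x k, u⟫) l (𝓝 ⟪p, u⟫)) :
    Tendsto (fun k => toWeakSpace ℝ H (x k)) l (𝓝 (toWeakSpace ℝ H p)) := by
  have heval (f : StrongDual ℝ H) : Tendsto (fun k => f (x k)) l (𝓝 (f p)) := by
    have hf (y : H) : ⟪y, (InnerProductSpace.toDual ℝ H).symm f⟫ = f y := by
      rw [real_inner_comm, InnerProductSpace.toDual_symm_apply]
    simpa only [hf] using hx ((InnerProductSpace.toDual ℝ H).symm f)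
  exact (Topology.IsInducing.tendsto_nhds_iff ⟨rfl⟩).2 (tendsto_pi_nhds.2 heval)

/-- If `x_k ⇀ x̄` and `x̃_k ⇀ x̄` weakly in a real Hilbert space,
then `{x̄} ∪ ⋃ₖ [x_k, x̃_k]` is weakly compact; in particular `⋃ₖ [x_k, x̄]` is
weakly compact.  Weak compactness of `A ⊆ H` is expressed as compactness of the
image of `A` in `WeakSpace ℝ H`. -/
theorem stmt_1
    {H : Type*} [NormedAddCommGroup H] [InnerProductSpace ℝ H] [CompleteSpace H]
    (x xt : ℕ → H) (xbar : H)
    (hx : ∀ u : H, Tendsto (fun k => ⟪x k, u⟫) atTop (nhds ⟪xbar, u⟫))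
    (hxt : ∀ u : H, Tendsto (fun k => ⟪xt k, u⟫) atTop (nhds ⟪xbar, u⟫)) :
    IsCompact (toWeakSpace ℝ H '' ({xbar} ∪ ⋃ k : ℕ, segment ℝ (x k) (xt k)))
      ∧ IsCompact (toWeakSpace ℝ H '' (⋃ k : ℕ, segment ℝ (x k) xbar)) := by
  have key : ∀ z : ℕ → H, (∀ u : H, Tendsto (fun k => ⟪z k, u⟫) atTop (nhds ⟪xbar, u⟫)) →
      IsCompact (toWeakSpace ℝ H '' ({xbar} ∪ ⋃ k : ℕ, segment ℝ (x k) (z k))) := by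
    intro z hz
    have h := isCompact_insert_iUnion_segment (tendsto_toWeakSpace_of_forall_inner hx)
      (tendsto_toWeakSpace_of_forall_inner hz)
    have himage (a b : H) : toWeakSpace ℝ H '' segment ℝ a b =
        segment ℝ (toWeakSpace ℝ H a) (toWeakSpace ℝ H b) :=
      image_segment ℝ (toWeakSpace ℝ H).toLinearMap.toAffineMap a b
    simpa only [Set.image_union, Set.image_singleton, Set.image_iUnion, himage] using h
  refine ⟨key xt hxt, ?_⟩
  have h := key (fun _ => xbar) fun u => tendsto_const_nhds
  have hmem : {xbar} ⊆ ⋃ k : ℕ, segment ℝ (x k) xbar :=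
    Set.singleton_subset_iff.2 (Set.mem_iUnion.2 ⟨0, right_mem_segment ℝ _ _⟩)
  rwa [Set.union_eq_right.2 hmem] at h
end

section
/- Let H be a real Hilbert space, let Ω ⊂ H be open, let f : Ω → ℝ, and let C ⊂ Ω be convex such that f is Gâteaux differentiable at every point of C with gradient ∇f, and ∇f is uniformly continuous on every weakly compact subset of C. Let (x_k) and (x̃_k) be sequences in C and x̄ ∈ C with x_k ⇀ x̄ weakly and ‖x̃_k − x_k‖ → 0. Then: (a) ‖∇f(x̃_k) − ∇f(x_k)‖ → 0; and (b) for every ε > 0 there exists δ > 0 such that for every k ∈ ℕ, if ‖x̃_k − x_k‖ ≤ δ then |f(x̃_k) − f(x_k) − ⟪x̃_k − x_k, ∇f(x_k)⟫| ≤ ε‖x̃_k − x_k‖. -/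
open scoped RealInnerProductSpace
open Filter Topology

/-- If `x k ⇀ a` weakly and `y k - x k → 0` in norm, then the segments `[x k, y k]` together with
the limit `a` form a weakly compact set. -/
theorem isCompact_toWeakSpace_image_insert_iUnion_segment
    {H : Type*} [NormedAddCommGroup H] [InnerProductSpace ℝ H] [CompleteSpace H]
    {x y : ℕ → H} {a : H}
    (hx : ∀ u : H, Tendsto (fun k => ⟪x k, u⟫) atTop (𝓝 ⟪a, u⟫))
    (hxy : Tendsto (fun k => ‖y k - x k‖) atTop (𝓝 0)) :
    IsCompact (toWeakSpace ℝ H '' insert a (⋃ k, segment ℝ (x k) (y k))) := by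
  let g : ℕ × Set.Icc (0 : ℝ) 1 → H := fun p => x p.1 + (p.2 : ℝ) • (y p.1 - x p.1)
  have hg : insert a (⋃ k, segment ℝ (x k) (y k)) = insert a (Set.range g) := by
    congr 1
    ext z
    simp [g, segment_eq_image']
  have hcont : Continuous g := by
    rw [continuous_prod_of_discrete_left]
    intro k
    simp only [g]
    fun_prop
  have hfst : Tendsto (Prod.fst : ℕ × Set.Icc (0 : ℝ) 1 → ℕ) (cocompact _) atTop := by
    rw [← coprod_cocompact, Filter.coprod, cocompact_eq_bot (X := Set.Icc (0 : ℝ) 1), comap_bot, sup_bot_eq,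
      cocompact_eq_cofinite, Nat.cofinite_eq_atTop]
    exact tendsto_comap
  have hsmall : Tendsto (fun p : ℕ × Set.Icc (0 : ℝ) 1 => (p.2 : ℝ) • (y p.1 - x p.1))
      (cocompact _) (𝓝 0) := by
    refine squeeze_zero_norm (fun p => ?_) (hxy.comp hfst)
    rw [norm_smul, Real.norm_of_nonneg p.2.2.1]
    exact mul_le_of_le_one_left (norm_nonneg _) p.2.2.2
  have hlim : Tendsto (fun p => toWeakSpace ℝ H (g p)) (cocompact _) (𝓝 (toWeakSpace ℝ H a)) := by
    have hinj : Function.Injective (topDualPairing ℝ H).flip := fun v w h =>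
      ext_inner_left ℝ fun u => DFunLike.congr_fun h (InnerProductSpace.toDual ℝ H u)
    refine (WeakBilin.tendsto_iff_forall_eval_tendsto _ hinj).2 fun l => ?_
    obtain ⟨u, rfl⟩ := (InnerProductSpace.toDual ℝ H).surjective l
    have h := ((hx u).comp hfst).add (hsmall.inner (tendsto_const_nhds (x := u)))
    simp only [inner_zero_left, add_zero, Function.comp_def, ← inner_add_left] at h
    simp only [real_inner_comm u] at h
    exact h
  rw [hg, Set.image_insert_eq, ← Set.range_comp]
  exact hlim.isCompact_insert_range_of_cocompact ((toWeakSpaceCLM ℝ H).continuous.comp hcont)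

/-- A first-order Taylor estimate along a segment for a function with directional derivatives
`⟪d, f' z⟫`, in terms of the oscillation of `f'` on the segment. -/
theorem abs_sub_sub_inner_le_of_segment
    {H : Type*} [NormedAddCommGroup H] [InnerProductSpace ℝ H]
    {f : H → ℝ} {f' : H → H} {x y : H} {ε : ℝ}
    (hf : ∀ z ∈ segment ℝ x y,
      Tendsto (fun t : ℝ => (f (z + t • (y - x)) - f z) / t) (𝓝[≠] 0) (𝓝 ⟪y - x, f' z⟫))
    (hε : ∀ z ∈ segment ℝ x y, ‖f' z - f' x‖ ≤ ε) :
    |f y - f x - ⟪y - x, f' x⟫| ≤ ε * ‖y - x‖ := by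
  have hmem : ∀ t ∈ Set.Icc (0 : ℝ) 1, x + t • (y - x) ∈ segment ℝ x y := fun t ht => by
    rw [segment_eq_image']
    exact ⟨t, ht, rfl⟩
  have hderiv : ∀ t ∈ Set.Icc (0 : ℝ) 1,
      HasDerivWithinAt (fun t : ℝ => f (x + t • (y - x)) - t * ⟪y - x, f' x⟫)
        (⟪y - x, f' (x + t • (y - x))⟫ - 1 * ⟪y - x, f' x⟫) (Set.Icc 0 1) t := by
    intro t ht
    refine (HasDerivAt.sub ?_ ((hasDerivAt_id t).mul_const _)).hasDerivWithinAt
    rw [hasDerivAt_iff_tendsto_slope_zero]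
    refine (hf _ (hmem t ht)).congr fun s => ?_
    rw [smul_eq_mul, div_eq_inv_mul, add_smul, add_assoc]
  have hbound : ∀ t ∈ Set.Icc (0 : ℝ) 1,
      ‖⟪y - x, f' (x + t • (y - x))⟫ - 1 * ⟪y - x, f' x⟫‖ ≤ ε * ‖y - x‖ := by
    intro t ht
    rw [one_mul, ← inner_sub_right, mul_comm]
    exact (norm_inner_le_norm _ _).trans
      (mul_le_mul_of_nonneg_left (hε _ (hmem t ht)) (norm_nonneg _))
  have h := (convex_Icc (0 : ℝ) 1).norm_image_sub_le_of_norm_hasDerivWithin_le hderiv hbound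
    (Set.left_mem_Icc.2 zero_le_one) (Set.right_mem_Icc.2 zero_le_one)
  simpa [Real.norm_eq_abs, sub_right_comm] using h

/-- Let `f` be Gâteaux differentiable on a convex subset `C` of an
open set `Ω` in a real Hilbert space, with gradient `f'` uniformly continuous on
every weakly compact subset of `C`.  If `x_k ⇀ x̄ ∈ C` weakly and
`‖x̃_k − x_k‖ → 0` (both sequences in `C`), then (a) `‖f'(x̃_k) − f'(x_k)‖ → 0`,
and (b) for every `ε > 0` there is `δ > 0` such that `‖x̃_k − x_k‖ ≤ δ` implies
`|f(x̃_k) − f(x_k) − ⟪x̃_k − x_k, f'(x_k)⟫| ≤ ε‖x̃_k − x_k‖`. -/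
theorem stmt_2
    {H : Type*} [NormedAddCommGroup H] [InnerProductSpace ℝ H] [CompleteSpace H]
    (Ω C : Set H) (hΩ : IsOpen Ω) (hCΩ : C ⊆ Ω) (hC : Convex ℝ C)
    (f : H → ℝ) (f' : H → H)
    (hgat : ∀ x ∈ C, ∀ d : H,
      Tendsto (fun t : ℝ => (f (x + t • d) - f x) / t) (nhdsWithin 0 {(0 : ℝ)}ᶜ)
        (nhds ⟪d, f' x⟫))
    (hunif : ∀ A : Set H, A ⊆ C → IsCompact (toWeakSpace ℝ H '' A) →
      ∀ ε > (0 : ℝ), ∃ δ > (0 : ℝ), ∀ a ∈ A, ∀ b ∈ A, ‖a - b‖ ≤ δ → ‖f' a - f' b‖ ≤ ε)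
    (x xt : ℕ → H) (hxC : ∀ k, x k ∈ C) (hxtC : ∀ k, xt k ∈ C)
    (xbar : H) (hxbar : xbar ∈ C)
    (hweak : ∀ u : H, Tendsto (fun k => ⟪x k, u⟫) atTop (nhds ⟪xbar, u⟫))
    (hdiff : Tendsto (fun k => ‖xt k - x k‖) atTop (nhds 0)) :
    Tendsto (fun k => ‖f' (xt k) - f' (x k)‖) atTop (nhds 0)
      ∧ ∀ ε > (0 : ℝ), ∃ δ > (0 : ℝ), ∀ k : ℕ, ‖xt k - x k‖ ≤ δ →
          |f (xt k) - f (x k) - ⟪xt k - x k, f' (x k)⟫| ≤ ε * ‖xt k - x k‖ := by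
  have hsub : insert xbar (⋃ k, segment ℝ (x k) (xt k)) ⊆ C :=
    Set.insert_subset hxbar (Set.iUnion_subset fun k => hC.segment_subset (hxC k) (hxtC k))
  have hosc := hunif _ hsub (isCompact_toWeakSpace_image_insert_iUnion_segment hweak hdiff)
  have hseg : ∀ k, segment ℝ (x k) (xt k) ⊆ insert xbar (⋃ k, segment ℝ (x k) (xt k)) := fun k =>
    (Set.subset_iUnion (fun k => segment ℝ (x k) (xt k)) k).trans (Set.subset_insert _ _)
  have hleft := fun k => hseg k (left_mem_segment ℝ (x k) (xt k))
  constructor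
  · rw [Metric.tendsto_nhds]
    intro ε hε
    obtain ⟨δ, hδ, h⟩ := hosc (ε / 2) (half_pos hε)
    filter_upwards [hdiff.eventually_le_const hδ] with k hk
    rw [dist_zero_right, norm_norm]
    exact (h _ (hseg k (right_mem_segment ℝ _ _)) _ (hleft k) hk).trans_lt (half_lt_self hε)
  · intro ε hε
    obtain ⟨δ, hδ, h⟩ := hosc ε hε
    refine ⟨δ, hδ, fun k hk => abs_sub_sub_inner_le_of_segment
      (fun z hz => hgat z (hsub (hseg k hz)) _) fun z hz => h z (hseg k hz) _ (hleft k) ?_⟩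
    have hdist := dist_add_dist_of_mem_segment hz
    rw [← dist_eq_norm, dist_comm] at hk ⊢
    linarith [dist_nonneg (x := z) (y := xt k)]
end

section
/- Let H be a real Hilbert space, let Ω ⊂ H be open, let f : Ω → ℝ, and let C ⊂ Ω be convex such that f is Gâteaux differentiable at every point of C with gradient ∇f, and ∇f is Lipschitz continuous on every weakly compact subset of C. Let (x_k) and (x̃_k) be sequences in C and x̄ ∈ C with x_k ⇀ x̄ weakly and ‖x̃_k − x_k‖ → 0. Then there exists L > 0 such that for every k ∈ ℕ: ‖∇f(x̃_k) − ∇f(x_k)‖ ≤ L‖x̃_k − x_k‖ and |f(x̃_k) − f(x_k) − ⟪x̃_k − x_k, ∇f(x_k)⟫| ≤ (L/2)‖x̃_k − x_k‖². -/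
open scoped RealInnerProductSpace
open Filter Topology

/-- Weak convergence tested against inner products is convergence in `WeakSpace ℝ H`. -/
theorem tendsto_toWeakSpace_of_inner {H : Type*} [NormedAddCommGroup H]
    [InnerProductSpace ℝ H] [CompleteSpace H] {ι : Type*} {l : Filter ι} {x : ι → H} {a : H}
    (h : ∀ u : H, Tendsto (fun k => ⟪x k, u⟫) l (𝓝 ⟪a, u⟫)) :
    Tendsto (fun k => toWeakSpace ℝ H (x k)) l (𝓝 (toWeakSpace ℝ H a)) := by
  have hind : IsInducing
      (fun (y : WeakSpace ℝ H) (φ : StrongDual ℝ H) => (topDualPairing ℝ H).flip y φ) := ⟨rfl⟩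
  refine hind.tendsto_nhds_iff.2 (tendsto_pi_nhds.2 fun φ => ?_)
  obtain ⟨u, rfl⟩ := (InnerProductSpace.toDual ℝ H).surjective φ
  change Tendsto (fun k => ⟪u, x k⟫) l (𝓝 ⟪u, a⟫)
  rw [real_inner_comm]
  exact (h u).congr fun k => real_inner_comm _ _

/-- The segments `[x k, x k + d k]`, together with the weak limit of `x`, form a weakly compact
set when `d` tends weakly to zero. -/
theorem isCompact_image_segments {E : Type*} [AddCommGroup E] [Module ℝ E] [TopologicalSpace E]
    [ContinuousAdd E] [ContinuousSMul ℝ E] {x d : ℕ → E} {a : E}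
    (hx : Tendsto x atTop (𝓝 a)) (hd : Tendsto d atTop (𝓝 0)) :
    IsCompact ((fun q : (E × E) × ℝ => q.1.1 + q.2 • q.1.2) ''
      (insert (a, 0) (Set.range fun k => (x k, d k)) ×ˢ Set.Icc (0 : ℝ) 1)) :=
  ((hx.prodMk_nhds hd).isCompact_insert_range.prod isCompact_Icc).image (by fun_prop)

/-- A function along a line is differentiable where its difference quotients converge. -/
theorem hasDerivAt_comp_line {H : Type*} [NormedAddCommGroup H] [InnerProductSpace ℝ H]
    {f : H → ℝ} {x d : H} {t c : ℝ}
    (h : Tendsto (fun s : ℝ => (f (x + t • d + s • d) - f (x + t • d)) / s) (𝓝[≠] 0) (𝓝 c)) :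
    HasDerivAt (fun s : ℝ => f (x + s • d)) c t := by
  rw [hasDerivAt_iff_tendsto_slope_zero]
  refine h.congr fun s => ?_
  rw [add_smul, ← add_assoc, smul_eq_mul, div_eq_inv_mul]

/-- Descent estimate along a segment. -/
theorem abs_sub_sub_inner_le {H : Type*} [NormedAddCommGroup H] [InnerProductSpace ℝ H]
    {f : H → ℝ} {f' : H → H} {x d : H} {L : ℝ}
    (hf : ∀ t ∈ Set.Icc (0 : ℝ) 1,
      HasDerivAt (fun s : ℝ => f (x + s • d)) ⟪d, f' (x + t • d)⟫ t)
    (hL : ∀ t ∈ Set.Icc (0 : ℝ) 1, ‖f' (x + t • d) - f' x‖ ≤ L * ‖t • d‖) :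
    |f (x + d) - f x - ⟪d, f' x⟫| ≤ L / 2 * ‖d‖ ^ 2 := by
  have hg : ∀ t ∈ Set.Icc (0 : ℝ) 1,
      HasDerivAt (fun s : ℝ => f (x + s • d) - f x - s * ⟪d, f' x⟫)
        (⟪d, f' (x + t • d)⟫ - ⟪d, f' x⟫) t := fun t ht => by
    refine (((hf t ht).sub_const (f x)).sub
      ((hasDerivAt_id t).mul_const ⟪d, f' x⟫)).congr_deriv ?_
    rw [one_mul]
  have hB : ∀ t : ℝ, HasDerivAt (fun s : ℝ => L / 2 * ‖d‖ ^ 2 * s ^ 2)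
      (L * ‖d‖ ^ 2 * t) t := fun t => by
    refine ((hasDerivAt_pow 2 t).const_mul (L / 2 * ‖d‖ ^ 2)).congr_deriv ?_
    norm_num
    ring
  have key := image_norm_le_of_norm_deriv_right_le_deriv_boundary
    (fun t ht => (hg t ht).continuousAt.continuousWithinAt)
    (fun t ht => (hg t (Set.Ico_subset_Icc_self ht)).hasDerivWithinAt)
    (by simp) hB (fun t ht => ?_) (Set.right_mem_Icc.2 zero_le_one)
  · simpa using key
  · rw [← inner_sub_right]
    calc ‖⟪d, f' (x + t • d) - f' x⟫‖ ≤ ‖d‖ * ‖f' (x + t • d) - f' x‖ := norm_inner_le_norm _ _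
      _ ≤ ‖d‖ * (L * ‖t • d‖) := by gcongr; exact hL t (Set.Ico_subset_Icc_self ht)
      _ = L * ‖d‖ ^ 2 * t := by rw [norm_smul, Real.norm_of_nonneg ht.1]; ring

/-- Let `f` be Gâteaux differentiable on a convex subset `C` of an
open set `Ω` in a real Hilbert space, with gradient `f'` Lipschitz continuous on
every weakly compact subset of `C`.  If `x_k ⇀ x̄ ∈ C` weakly and
`‖x̃_k − x_k‖ → 0` (both sequences in `C`), then there is `L > 0` such that for
every `k`, `‖f'(x̃_k) − f'(x_k)‖ ≤ L‖x̃_k − x_k‖` and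
`|f(x̃_k) − f(x_k) − ⟪x̃_k − x_k, f'(x_k)⟫| ≤ (L/2)‖x̃_k − x_k‖²`. -/
theorem stmt_3
    {H : Type*} [NormedAddCommGroup H] [InnerProductSpace ℝ H] [CompleteSpace H]
    (Ω C : Set H) (hΩ : IsOpen Ω) (hCΩ : C ⊆ Ω) (hC : Convex ℝ C)
    (f : H → ℝ) (f' : H → H)
    (hgat : ∀ x ∈ C, ∀ d : H,
      Tendsto (fun t : ℝ => (f (x + t • d) - f x) / t) (nhdsWithin 0 {(0 : ℝ)}ᶜ)
        (nhds ⟪d, f' x⟫))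
    (hlip : ∀ A : Set H, A ⊆ C → IsCompact (toWeakSpace ℝ H '' A) →
      ∃ L : ℝ, ∀ a ∈ A, ∀ b ∈ A, ‖f' a - f' b‖ ≤ L * ‖a - b‖)
    (x xt : ℕ → H) (hxC : ∀ k, x k ∈ C) (hxtC : ∀ k, xt k ∈ C)
    (xbar : H) (hxbar : xbar ∈ C)
    (hweak : ∀ u : H, Tendsto (fun k => ⟪x k, u⟫) atTop (nhds ⟪xbar, u⟫))
    (hdiff : Tendsto (fun k => ‖xt k - x k‖) atTop (nhds 0)) :
    ∃ L > (0 : ℝ), ∀ k : ℕ,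
      ‖f' (xt k) - f' (x k)‖ ≤ L * ‖xt k - x k‖
        ∧ |f (xt k) - f (x k) - ⟪xt k - x k, f' (x k)⟫| ≤ L / 2 * ‖xt k - x k‖ ^ 2 := by
  have hd : Tendsto (fun k => toWeakSpace ℝ H (xt k - x k)) atTop (𝓝 0) := by
    have h := (toWeakSpaceCLM ℝ H).continuous.tendsto 0
    rw [map_zero] at h
    exact h.comp (tendsto_zero_iff_norm_tendsto_zero.2 hdiff)
  have hcompact := isCompact_image_segments (tendsto_toWeakSpace_of_inner hweak) hd
  have hseg : ∀ k, ∀ t ∈ Set.Icc (0 : ℝ) 1, x k + t • (xt k - x k) ∈ C := fun k t ht =>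
    hC.add_smul_sub_mem (hxC k) (hxtC k) ht
  set A : Set H := insert xbar {y | ∃ k, ∃ t ∈ Set.Icc (0 : ℝ) 1, x k + t • (xt k - x k) = y}
  have hAC : A ⊆ C := by
    rintro y (rfl | ⟨k, t, ht, rfl⟩)
    · exact hxbar
    · exact hseg k t ht
  have hAcompact : IsCompact (toWeakSpace ℝ H '' A) := by
    convert hcompact using 1
    ext w
    constructor
    · rintro ⟨y, rfl | ⟨k, t, ht, rfl⟩, rfl⟩
      · exact ⟨((toWeakSpace ℝ H y, 0), 0), ⟨Or.inl rfl, by simp⟩, by simp⟩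
      · exact ⟨((toWeakSpace ℝ H (x k), toWeakSpace ℝ H (xt k - x k)), t),
          ⟨Or.inr ⟨k, rfl⟩, ht⟩, by simp⟩
    · rintro ⟨⟨p, t⟩, ⟨rfl | ⟨k, rfl⟩, ht⟩, rfl⟩
      · exact ⟨xbar, Or.inl rfl, by simp⟩
      · exact ⟨_, Or.inr ⟨k, t, ht, rfl⟩, by simp⟩
  obtain ⟨L, hL⟩ := hlip A hAC hAcompact
  have hmem : ∀ k, ∀ t ∈ Set.Icc (0 : ℝ) 1, x k + t • (xt k - x k) ∈ A := fun k t ht =>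
    Or.inr ⟨k, t, ht, rfl⟩
  have hxA : ∀ k, x k ∈ A := fun k => by simpa using hmem k 0 (by simp)
  have hLip : ∀ k, ∀ t ∈ Set.Icc (0 : ℝ) 1,
      ‖f' (x k + t • (xt k - x k)) - f' (x k)‖ ≤ max L 1 * ‖t • (xt k - x k)‖ := fun k t ht => by
    have h := hL _ (hmem k t ht) _ (hxA k)
    rw [add_sub_cancel_left] at h
    exact h.trans (by gcongr; exact le_max_left L 1)
  refine ⟨max L 1, by positivity, fun k => ⟨?_, ?_⟩⟩
  · simpa using hLip k 1 (by simp)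
  · simpa using abs_sub_sub_inner_le
      (fun t ht => hasDerivAt_comp_line (hgat _ (hseg k t ht) _)) (hLip k)
end

section
/- Let H be a real Hilbert space, let Ω ⊂ H be a nonempty open set, let f : Ω → ℝ, and let C ⊂ Ω be a nonempty convex set such that f is Gâteaux differentiable at every point of C with gradient ∇f, and ∇f is uniformly continuous on every weakly compact subset of C. Then for every x̄ ∈ C, |f(x) − f(x̄) − ⟪x − x̄, ∇f(x̄)⟫| / ‖x − x̄‖ → 0 as x → x̄ with x ∈ C, x ≠ x̄ (i.e., f is Fréchet-like differentiable at x̄ along C). -/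
open scoped RealInnerProductSpace
open Filter Topology

/-- A map is continuous within `C` at `x` if its restriction to every compact subset of `C` through
`x` is continuous within that subset at `x`. -/
theorem continuousWithinAt_of_forall_isCompact {X Y : Type*} [PseudoMetricSpace X]
    [PseudoMetricSpace Y] {C : Set X} {g : X → Y} {x : X} (hx : x ∈ C)
    (h : ∀ A ⊆ C, IsCompact A → x ∈ A → ContinuousWithinAt g A x) :
    ContinuousWithinAt g C x := by
  rw [Metric.continuousWithinAt_iff]
  by_contra! hcon
  obtain ⟨ε, hε, hcon⟩ := hcon
  choose u huC hux hug using fun n : ℕ => hcon (1 / ((n : ℝ) + 1)) (by positivity)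
  have hu : Tendsto u atTop (𝓝 x) :=
    tendsto_iff_dist_tendsto_zero.2 <| squeeze_zero (fun _ => dist_nonneg)
      (fun n => (hux n).le) tendsto_one_div_add_atTop_nhds_zero_nat
  obtain ⟨δ, hδ, hg⟩ := Metric.continuousWithinAt_iff.1
    (h (insert x (Set.range u)) (Set.insert_subset hx (Set.range_subset_iff.2 huC))
      hu.isCompact_insert_range (Set.mem_insert _ _)) ε hε
  obtain ⟨n, hn⟩ := (Metric.tendsto_nhds.1 hu δ hδ).exists
  exact (hug n).not_gt (hg (Set.mem_insert_of_mem _ (Set.mem_range_self n)) hn)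

/-- Mean value inequality for a function with a Gâteaux gradient along the segment from `x` to
`y`. -/
theorem abs_sub_sub_inner_le_of_gateaux_segment {H : Type*} [NormedAddCommGroup H]
    [InnerProductSpace ℝ H] {f : H → ℝ} {f' : H → H} {x y v : H} {ε : ℝ}
    (hgat : ∀ z ∈ segment ℝ x y,
      Tendsto (fun t : ℝ => (f (z + t • (y - x)) - f z) / t) (𝓝[≠] 0) (𝓝 ⟪y - x, f' z⟫))
    (hbound : ∀ z ∈ segment ℝ x y, ‖f' z - v‖ ≤ ε) :
    |f y - f x - ⟪y - x, v⟫| ≤ ε * ‖y - x‖ := by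
  have hmem : ∀ t ∈ Set.Icc (0 : ℝ) 1, x + t • (y - x) ∈ segment ℝ x y := fun t ht => by
    rw [segment_eq_image']
    exact ⟨t, ht, rfl⟩
  have hderiv : ∀ t ∈ Set.Icc (0 : ℝ) 1,
      HasDerivAt (fun s : ℝ => f (x + s • (y - x)) - s * ⟪y - x, v⟫)
        (⟪y - x, f' (x + t • (y - x))⟫ - 1 * ⟪y - x, v⟫) t := fun t ht => by
    refine HasDerivAt.sub ?_ ((hasDerivAt_id t).mul_const _)
    rw [hasDerivAt_iff_tendsto_slope_zero]
    refine (hgat _ (hmem t ht)).congr fun s => ?_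
    rw [add_smul, ← add_assoc, smul_eq_mul, div_eq_inv_mul]
  have key := norm_image_sub_le_of_norm_deriv_le_segment_01' (C := ε * ‖y - x‖)
    (fun t ht => (hderiv t ht).hasDerivWithinAt) fun t ht => by
      rw [one_mul, ← inner_sub_right, mul_comm ε]
      exact (norm_inner_le_norm _ _).trans
        (mul_le_mul_of_nonneg_left (hbound _ (hmem t (Set.Ico_subset_Icc_self ht)))
          (norm_nonneg _))
  simpa [Real.norm_eq_abs, sub_right_comm] using key

/-- Let `f` be Gâteaux differentiable on a nonempty convex subset
`C` of a nonempty open set `Ω` in a real Hilbert space, with gradient `f'`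
uniformly continuous on every weakly compact subset of `C`.  Then for every
`x̄ ∈ C`, `|f(x) − f(x̄) − ⟪x − x̄, f'(x̄)⟫| / ‖x − x̄‖ → 0` as `x → x̄` with
`x ∈ C`, `x ≠ x̄`. -/
theorem stmt_5
    {H : Type*} [NormedAddCommGroup H] [InnerProductSpace ℝ H] [CompleteSpace H]
    (Ω C : Set H) (hΩ : IsOpen Ω) (hΩne : Ω.Nonempty) (hCΩ : C ⊆ Ω)
    (hC : Convex ℝ C) (hCne : C.Nonempty)
    (f : H → ℝ) (f' : H → H)
    (hgat : ∀ x ∈ C, ∀ d : H,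
      Tendsto (fun t : ℝ => (f (x + t • d) - f x) / t) (nhdsWithin 0 {(0 : ℝ)}ᶜ)
        (nhds ⟪d, f' x⟫))
    (hunif : ∀ A : Set H, A ⊆ C → IsCompact (toWeakSpace ℝ H '' A) →
      ∀ ε > (0 : ℝ), ∃ δ > (0 : ℝ), ∀ a ∈ A, ∀ b ∈ A, ‖a - b‖ ≤ δ → ‖f' a - f' b‖ ≤ ε) :
    ∀ xbar ∈ C,
      Tendsto (fun x : H => |f x - f xbar - ⟪x - xbar, f' xbar⟫| / ‖x - xbar‖)
        (nhdsWithin xbar (C \ {xbar})) (nhds 0) := by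
  intro xbar hxbar
  have hcont : ContinuousWithinAt f' C xbar :=
    continuousWithinAt_of_forall_isCompact hxbar fun A hAC hA hxA => by
      rw [Metric.continuousWithinAt_iff]
      intro ε hε
      obtain ⟨δ, hδ, h⟩ := hunif A hAC (hA.image (toWeakSpaceCLM ℝ H).continuous) (ε / 2)
        (half_pos hε)
      refine ⟨δ, hδ, fun x hx hd => ?_⟩
      rw [dist_eq_norm] at hd ⊢
      exact (h x hx xbar hxA hd.le).trans_lt (half_lt_self hε)
  rw [Metric.tendsto_nhdsWithin_nhds]
  intro ε hε
  obtain ⟨δ, hδ, h⟩ := Metric.continuousWithinAt_iff.1 hcont (ε / 2) (half_pos hε)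
  refine ⟨δ, hδ, fun x hx hd => ?_⟩
  have hseg : segment ℝ xbar x ⊆ C := hC.segment_subset hxbar hx.1
  have hball : segment ℝ xbar x ⊆ Metric.ball xbar δ :=
    (convex_ball xbar δ).segment_subset (Metric.mem_ball_self hδ) hd
  have hpos : 0 < ‖x - xbar‖ := norm_pos_iff.2 (sub_ne_zero.2 hx.2)
  have key := abs_sub_sub_inner_le_of_gateaux_segment (v := f' xbar) (ε := ε / 2)
    (fun z hz => hgat z (hseg hz) (x - xbar))
    fun z hz => by
      rw [← dist_eq_norm]
      exact (h (hseg hz) (hball hz)).le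
  rw [Real.dist_0_eq_abs, abs_of_nonneg (by positivity)]
  exact ((div_le_iff₀ hpos).2 key).trans_lt (half_lt_self hε)
end

section
/- Let H be a real Hilbert space and let f, g : H → (−∞,+∞] be proper, convex and lower semicontinuous with dom g ⊂ dom f, and assume f is Gâteaux differentiable at every point of dom g with gradient ∇f. Let x ∈ dom g and γ > 0, and set y = prox_{γg}(x − γ∇f(x)). Let u ∈ H and c ∈ ℝ be such that ⟪z, u⟫ − g(z) ≤ c for every z ∈ H. Then ‖y − x‖ ≤ γ‖∇f(x)‖ + sqrt( 2γ·( g(x) + c − ⟪x, u⟫ + γ‖u‖²/2 ) ). -/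
open scoped RealInnerProductSpace
open Filter Topology

attribute [local instance] Classical.propDecidable

/-- An explicit bound for the solutions of a quadratic inequality. -/
theorem le_add_sqrt_of_sq_le {a b n s : ℝ} (ha : 0 ≤ a) (hs : 0 ≤ s)
    (h : n ^ 2 ≤ s + n * a + n * b) :
    n ≤ a + Real.sqrt (2 * s + b ^ 2) := by
  rw [← sub_le_iff_le_add']
  rcases le_total (n - a) b with hm | hm
  · exact hm.trans (Real.le_sqrt_of_sq_le (by linarith))
  · refine Real.le_sqrt_of_sq_le ?_
    nlinarith [mul_nonneg ha (sub_nonneg.2 hm), sq_nonneg (n - a - b)]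

/-- Bound on the length of a forward–backward step.  Proper convex
lsc functions are modeled by pairs `(domf, f)` and `(domg, g)` of (nonempty)
domains and real values there, with lower semicontinuity of the extended
functions.  `y = prox_{γg}(x − γ∇f(x))` is encoded by the subgradient inclusion
`((x − γ∇f(x)) − y)/γ ∈ ∂g(y)`, and `c` is an upper bound for the Fenchel
conjugate value `g*(u)`. -/
theorem stmt_6
    {H : Type*} [NormedAddCommGroup H] [InnerProductSpace ℝ H] [CompleteSpace H]
    (domf domg : Set H) (f g : H → ℝ)
    (hdomf_ne : domf.Nonempty) (hdomf_cvx : Convex ℝ domf)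
    (hf_cvx : ConvexOn ℝ domf f)
    (hf_lsc : LowerSemicontinuous fun z : H => if z ∈ domf then (f z : EReal) else ⊤)
    (hdomg_ne : domg.Nonempty) (hdomg_cvx : Convex ℝ domg)
    (hg_cvx : ConvexOn ℝ domg g)
    (hg_lsc : LowerSemicontinuous fun z : H => if z ∈ domg then (g z : EReal) else ⊤)
    (hdom : domg ⊆ domf)
    (f' : H → H)
    (hgat : ∀ z ∈ domg, ∀ d : H,
      Tendsto (fun t : ℝ => (f (z + t • d) - f z) / t) (nhdsWithin 0 {(0 : ℝ)}ᶜ)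
        (nhds ⟪d, f' z⟫))
    (x : H) (hx : x ∈ domg) (γ : ℝ) (hγ : 0 < γ)
    (y : H) (hy : y ∈ domg)
    (hprox : ∀ w ∈ domg, g y + ⟪w - y, γ⁻¹ • ((x - γ • f' x) - y)⟫ ≤ g w)
    (u : H) (c : ℝ) (hc : ∀ z ∈ domg, ⟪z, u⟫ - g z ≤ c) :
    ‖y - x‖ ≤ γ * ‖f' x‖
      + Real.sqrt (2 * γ * (g x + c - ⟪x, u⟫ + γ * ‖u‖ ^ 2 / 2)) := by
  have hA := hc x hx
  have hcy := hc y hy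
  have hpx := hprox x hx
  set A := g x + c - ⟪x, u⟫ with hAdef
  have hA0 : 0 ≤ A := by linarith
  have hinner : ⟪x - y, γ⁻¹ • ((x - γ • f' x) - y)⟫
      = γ⁻¹ * ‖y - x‖ ^ 2 + ⟪y - x, f' x⟫ := by
    have h : (x - γ • f' x) - y = -((y - x) + γ • f' x) := by abel
    rw [h, ← neg_sub y x, inner_smul_right, inner_neg_neg, inner_add_right,
      inner_smul_right, real_inner_self_eq_norm_sq]
    field_simp
  have hyu : ⟪y - x, u⟫ = ⟪y, u⟫ - ⟪x, u⟫ := inner_sub_left y x u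
  have hv := neg_le_of_abs_le (abs_real_inner_le_norm (y - x) (f' x))
  have hu := neg_le_of_abs_le (abs_real_inner_le_norm (y - x) u)
  have hsq : γ⁻¹ * ‖y - x‖ ^ 2 ≤ A + ‖y - x‖ * ‖f' x‖ + ‖y - x‖ * ‖u‖ := by linarith
  rw [inv_mul_le_iff₀ hγ] at hsq
  have key := le_add_sqrt_of_sq_le (a := γ * ‖f' x‖) (b := γ * ‖u‖) (n := ‖y - x‖)
    (by positivity) (mul_nonneg hγ.le hA0) (by linarith)
  convert key using 3
  ring
end

section
/- Let H be a real Hilbert space and let f, g : H → (−∞,+∞] be proper, convex and lower semicontinuous with dom g ⊂ dom f, and assume f is Gâteaux differentiable at every point of dom g with gradient ∇f. Let x, y ∈ dom g and suppose y − x is a descent direction for f + g at x, i.e., the one-sided directional derivative (f+g)′(x, y − x) = inf_{λ ∈ (0,1]} ((f+g)(x + λ(y − x)) − (f+g)(x))/λ is strictly negative (possibly −∞). Then for every δ ∈ (0,1) there exists λ₀ ∈ (0,1] such that for every λ ∈ (0, λ₀]: (f+g)(x + λ(y − x)) − (f+g)(x) ≤ (1 − δ)·λ·( g(y) − g(x)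 + ⟪y − x, ∇f(x)⟫ ). -/
open scoped RealInnerProductSpace
open Filter Topology

attribute [local instance] Classical.propDecidable

/-- Along a segment, the increment of a convex function is at most the corresponding fraction of
its total increment. -/
theorem ConvexOn.sub_le_mul_sub {E : Type*} [AddCommGroup E] [Module ℝ E] {s : Set E} {φ : E → ℝ}
    (hφ : ConvexOn ℝ s φ) {x y : E} (hx : x ∈ s) (hy : y ∈ s) {t : ℝ} (ht₀ : 0 ≤ t) (ht₁ : t ≤ 1) :
    φ (x + t • (y - x)) - φ x ≤ t * (φ y - φ x) := by
  have h := hφ.2 hx hy (sub_nonneg.2 ht₁) ht₀ (by ring)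
  rw [show (1 - t) • x + t • y = x + t • (y - x) by module, smul_eq_mul, smul_eq_mul] at h
  linarith

/-- Armijo-type line search along a descent direction.  Proper
convex lsc functions are modeled by pairs of domains and real values, with lower
semicontinuity of the extended functions.  The hypothesis that the one-sided
directional derivative `(f+g)′(x, y − x) = inf_{λ∈(0,1]}` of the difference
quotients is strictly negative (possibly `−∞`) is expressed equivalently as the
existence of some `λ ∈ (0,1]` with a strictly negative difference quotient. -/
theorem stmt_7
    {H : Type*} [NormedAddCommGroup H] [InnerProductSpace ℝ H] [CompleteSpace H]
    (domf domg : Set H) (f g : H → ℝ)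
    (hdomf_ne : domf.Nonempty) (hdomf_cvx : Convex ℝ domf)
    (hf_cvx : ConvexOn ℝ domf f)
    (hf_lsc : LowerSemicontinuous fun z : H => if z ∈ domf then (f z : EReal) else ⊤)
    (hdomg_ne : domg.Nonempty) (hdomg_cvx : Convex ℝ domg)
    (hg_cvx : ConvexOn ℝ domg g)
    (hg_lsc : LowerSemicontinuous fun z : H => if z ∈ domg then (g z : EReal) else ⊤)
    (hdom : domg ⊆ domf)
    (f' : H → H)
    (hgat : ∀ z ∈ domg, ∀ d : H,
      Tendsto (fun t : ℝ => (f (z + t • d) - f z) / t) (nhdsWithin 0 {(0 : ℝ)}ᶜ)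
        (nhds ⟪d, f' z⟫))
    (x y : H) (hx : x ∈ domg) (hy : y ∈ domg)
    (hdesc : ∃ lam : ℝ, 0 < lam ∧ lam ≤ 1 ∧
      ((f + g) (x + lam • (y - x)) - (f + g) x) / lam < 0) :
    ∀ δ : ℝ, 0 < δ → δ < 1 → ∃ lam₀ : ℝ, 0 < lam₀ ∧ lam₀ ≤ 1 ∧
      ∀ lam : ℝ, 0 < lam → lam ≤ lam₀ →
        (f + g) (x + lam • (y - x)) - (f + g) x
          ≤ (1 - δ) * lam * (g y - g x + ⟪y - x, f' x⟫) := by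
  intro δ hδ₀ hδ₁
  obtain hS | hS := le_or_gt 0 (g y - g x + ⟪y - x, f' x⟫)
  · obtain ⟨l, hl₀, hl₁, hneg⟩ := hdesc
    refine ⟨l, hl₀, hl₁, fun t ht₀ htl => ?_⟩
    have hdec : (f + g) (x + l • (y - x)) - (f + g) x < 0 := by
      simpa [hl₀.ne'] using mul_neg_of_neg_of_pos hneg hl₀
    have h := ((hf_cvx.subset hdom hdomg_cvx).add hg_cvx).sub_le_mul_sub hx
      (hdomg_cvx.add_smul_sub_mem hx hy ⟨hl₀.le, hl₁⟩) (div_nonneg ht₀.le hl₀.le)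
      ((div_le_one hl₀).2 htl)
    rw [add_sub_cancel_left, smul_smul, div_mul_cancel₀ _ hl₀.ne'] at h
    calc _ ≤ _ := h
      _ ≤ 0 := mul_nonpos_of_nonneg_of_nonpos (div_nonneg ht₀.le hl₀.le) hdec.le
      _ ≤ _ := mul_nonneg (mul_nonneg (sub_nonneg.2 hδ₁.le) ht₀.le) hS
  · have hlim := (hgat x hx (y - x)).mono_left
      (nhdsWithin_mono 0 fun t (ht : 0 < t) => ht.ne')
    have hlt : ⟪y - x, f' x⟫ < ⟪y - x, f' x⟫ - δ * (g y - g x + ⟪y - x, f' x⟫) := by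
      linarith [mul_neg_of_pos_of_neg hδ₀ hS]
    obtain ⟨ε, hε, hsub⟩ := mem_nhdsGT_iff_exists_Ioc_subset.1 (hlim.eventually_lt_const hlt)
    refine ⟨min ε 1, lt_min hε one_pos, min_le_right _ _, fun t ht₀ ht => ?_⟩
    have hf := hsub ⟨ht₀, ht.trans (min_le_left _ _)⟩
    rw [Set.mem_ofPred_eq, div_lt_iff₀ ht₀] at hf
    have hg := hg_cvx.sub_le_mul_sub hx hy ht₀.le (ht.trans (min_le_right _ _))
    simp only [Pi.add_apply]
    linarith
end

section
/- Let H be a real Hilbert space and let f, g : H → (−∞,+∞] be proper, convex and lower semicontinuous with dom g ⊂ dom f, and assume f is Gâteaux differentiable at every point of dom g with gradient ∇f. Let x ∈ dom g, γ > 0, λ ∈ (0,1], let y ∈ H satisfy (x − y)/γ − ∇f(x) ∈ ∂g(y), and set x⁺ = x + λ(y − x). Then for every z ∈ dom g: ‖x⁺ − z‖² ≤ ‖x − z‖² + 2γλ·( (f+g)(z) − (f+g)(x) ) − 2γλ·( g(y) − g(x) + ⟪y − x, ∇f(x)⟫ ) − ‖x⁺ − x‖². -/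
open scoped RealInnerProductSpace
open Filter Topology

attribute [local instance] Classical.propDecidable

/-- Gradient inequality: a directional derivative of a convex function along a segment of its
domain is at most the increment along that segment. -/
theorem ConvexOn.le_sub_of_tendsto_slope {E : Type*} [AddCommGroup E] [Module ℝ E]
    {s : Set E} {f : E → ℝ} (hf : ConvexOn ℝ s f) {x z : E} (hx : x ∈ s) (hz : z ∈ s) {l : ℝ}
    (hl : Tendsto (fun t : ℝ => (f (x + t • (z - x)) - f x) / t) (𝓝[>] 0) (𝓝 l)) :
    l ≤ f z - f x := by
  refine le_of_tendsto hl ?_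
  filter_upwards [Ioo_mem_nhdsGT (zero_lt_one' ℝ)] with t ht
  rw [div_le_iff₀ ht.1]
  have h := hf.2 hx hz (sub_nonneg.2 ht.2.le) ht.1.le (sub_add_cancel 1 t)
  have e : (1 - t) • x + t • z = x + t • (z - x) := by module
  rw [e, smul_eq_mul, smul_eq_mul] at h
  linarith

/-- The key quasi-Fejér inequality for one relaxed
forward–backward step `x⁺ = x + λ(y − x)` with
`y = prox_{γg}(x − γ∇f(x))`, encoded by `(x − y)/γ − ∇f(x) ∈ ∂g(y)`. -/
theorem stmt_9
    {H : Type*} [NormedAddCommGroup H] [InnerProductSpace ℝ H] [CompleteSpace H]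
    (domf domg : Set H) (f g : H → ℝ)
    (hdomf_ne : domf.Nonempty) (hdomf_cvx : Convex ℝ domf)
    (hf_cvx : ConvexOn ℝ domf f)
    (hf_lsc : LowerSemicontinuous fun z : H => if z ∈ domf then (f z : EReal) else ⊤)
    (hdomg_ne : domg.Nonempty) (hdomg_cvx : Convex ℝ domg)
    (hg_cvx : ConvexOn ℝ domg g)
    (hg_lsc : LowerSemicontinuous fun z : H => if z ∈ domg then (g z : EReal) else ⊤)
    (hdom : domg ⊆ domf)
    (f' : H → H)
    (hgat : ∀ z ∈ domg, ∀ d : H,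
      Tendsto (fun t : ℝ => (f (z + t • d) - f z) / t) (nhdsWithin 0 {(0 : ℝ)}ᶜ)
        (nhds ⟪d, f' z⟫))
    (x : H) (hx : x ∈ domg) (γ lam : ℝ) (hγ : 0 < γ) (hlam0 : 0 < lam) (hlam1 : lam ≤ 1)
    (y : H) (hy : y ∈ domg)
    (hprox : ∀ w ∈ domg, g y + ⟪w - y, γ⁻¹ • (x - y) - f' x⟫ ≤ g w)
    (xp : H) (hxp : xp = x + lam • (y - x)) :
    ∀ z ∈ domg,
      ‖xp - z‖ ^ 2 ≤ ‖x - z‖ ^ 2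
        + 2 * γ * lam * ((f + g) z - (f + g) x)
        - 2 * γ * lam * (g y - g x + ⟪y - x, f' x⟫)
        - ‖xp - x‖ ^ 2 := by
  intro z hz
  have hfz : ⟪z - x, f' x⟫ ≤ f z - f x :=
    hf_cvx.le_sub_of_tendsto_slope (hdom hx) (hdom hz)
      ((hgat x hx (z - x)).mono_left (nhdsWithin_mono _ fun _ h => ne_of_gt h))
  have hgz := hprox z hz
  obtain ⟨d, rfl⟩ : ∃ d, y = x + d := ⟨y - x, by abel⟩
  obtain ⟨e, rfl⟩ : ∃ e, z = x + e := ⟨z - x, by abel⟩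
  have e₁ : x + e - (x + d) = e - d := by abel
  have e₂ : x - (x + d) = -d := by abel
  have e₃ : x + lam • d - (x + e) = lam • d - e := by abel
  have e₄ : x - (x + e) = -e := by abel
  subst hxp
  simp only [e₁, e₂, e₃, e₄, add_sub_cancel_left, norm_neg, norm_sub_sq_real, norm_smul,
    Real.norm_eq_abs, mul_pow, sq_abs, inner_sub_left, inner_sub_right, inner_smul_left,
    inner_smul_right, inner_neg_right, real_inner_self_eq_norm_sq, RCLike.conj_to_real,
    Pi.add_apply, real_inner_comm d e] at hfz hgz ⊢
  have key : ‖d‖ ^ 2 - ⟪d, e⟫ ≤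
      γ * (f (x + e) - f x + g (x + e) - g (x + d) - ⟪d, f' x⟫) := by
    rw [← div_le_iff₀' hγ, div_eq_inv_mul]
    linarith
  have hlam : lam ^ 2 * ‖d‖ ^ 2 ≤ lam * ‖d‖ ^ 2 :=
    mul_le_mul_of_nonneg_right (by nlinarith) (sq_nonneg _)
  linarith [mul_le_mul_of_nonneg_left key hlam0.le]
end

section
/- Let H be a real Hilbert space and let f, g : H → (−∞,+∞] be proper, convex and lower semicontinuous with dom g ⊂ dom f, and assume f is Gâteaux differentiable at every point of dom g with gradient ∇f. Let x ∈ dom g, γ > 0, λ ∈ (0,1], δ ∈ (0,1), let y ∈ H satisfy (x − y)/γ − ∇f(x) ∈ ∂g(y), and set x⁺ = x + λ(y − x). If f(x⁺) − f(x) − ⟪x⁺ − x, ∇f(x)⟫ ≤ (δ/(γλ))·‖x⁺ − x‖², then (f+g)(x⁺) − (f+g)(x) ≤ (1 − δ)·λ·( g(y) − g(x) + ⟪y − x, ∇f(x)⟫ ). -/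
open scoped RealInnerProductSpace
open Filter Topology

attribute [local instance] Classical.propDecidable

/-- For a relaxed forward–backward step `x⁺ = x + λ(y − x)` with
`y = prox_{γg}(x − γ∇f(x))` (encoded by `(x − y)/γ − ∇f(x) ∈ ∂g(y)`), the
descent-lemma-type condition implies the Armijo-type sufficient decrease
condition. -/
theorem stmt_11
    {H : Type*} [NormedAddCommGroup H] [InnerProductSpace ℝ H] [CompleteSpace H]
    (domf domg : Set H) (f g : H → ℝ)
    (hdomf_ne : domf.Nonempty) (hdomf_cvx : Convex ℝ domf)
    (hf_cvx : ConvexOn ℝ domf f)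
    (hf_lsc : LowerSemicontinuous fun z : H => if z ∈ domf then (f z : EReal) else ⊤)
    (hdomg_ne : domg.Nonempty) (hdomg_cvx : Convex ℝ domg)
    (hg_cvx : ConvexOn ℝ domg g)
    (hg_lsc : LowerSemicontinuous fun z : H => if z ∈ domg then (g z : EReal) else ⊤)
    (hdom : domg ⊆ domf)
    (f' : H → H)
    (hgat : ∀ z ∈ domg, ∀ d : H,
      Tendsto (fun t : ℝ => (f (z + t • d) - f z) / t) (nhdsWithin 0 {(0 : ℝ)}ᶜ)
        (nhds ⟪d, f' z⟫))
    (x : H) (hx : x ∈ domg) (γ lam δ : ℝ)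
    (hγ : 0 < γ) (hlam0 : 0 < lam) (hlam1 : lam ≤ 1) (hδ0 : 0 < δ) (hδ1 : δ < 1)
    (y : H) (hy : y ∈ domg)
    (hprox : ∀ w ∈ domg, g y + ⟪w - y, γ⁻¹ • (x - y) - f' x⟫ ≤ g w)
    (xp : H) (hxp : xp = x + lam • (y - x))
    (hdesc : f xp - f x - ⟪xp - x, f' x⟫ ≤ δ / (γ * lam) * ‖xp - x‖ ^ 2) :
    (f + g) xp - (f + g) x ≤ (1 - δ) * lam * (g y - g x + ⟪y - x, f' x⟫) := by
  have hg_le : g xp ≤ g x + lam * (g y - g x) := by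
    have h := hg_cvx.2 hx hy (sub_nonneg.2 hlam1) hlam0.le (sub_add_cancel 1 lam)
    have hcomb : (1 - lam) • x + lam • y = xp := by rw [hxp]; module
    rw [hcomb, smul_eq_mul, smul_eq_mul] at h
    linarith
  have hprox_x : ‖y - x‖ ^ 2 / γ ≤ -(g y - g x + ⟪y - x, f' x⟫) := by
    have h := hprox x hx
    rw [inner_sub_right, real_inner_smul_right, real_inner_self_eq_norm_sq, norm_sub_rev x y,
      ← neg_sub y x, inner_neg_left] at h
    rw [div_eq_inv_mul]
    linarith
  have hsub : xp - x = lam • (y - x) := by rw [hxp]; abel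
  have hcoef : δ / (γ * lam) * (lam * ‖y - x‖) ^ 2 = δ * lam * (‖y - x‖ ^ 2 / γ) := by
    field_simp
  rw [hsub, real_inner_smul_left, norm_smul, Real.norm_of_nonneg hlam0.le, hcoef] at hdesc
  have hmul := mul_le_mul_of_nonneg_left hprox_x (mul_pos hδ0 hlam0).le
  simp only [Pi.add_apply]
  linarith
end

section
/- Let H be a real Hilbert space and let f, g : H → (−∞,+∞] be proper, convex and lower semicontinuous with dom g ⊂ dom f, and assume f is Gâteaux differentiable at every point of dom g with gradient ∇f. Let x ∈ dom g, γ > 0, λ ∈ (0,1], δ ∈ (0,1), let y ∈ H satisfy (x − y)/γ − ∇f(x) ∈ ∂g(y), and set x⁺ = x + λ(y − x). If (f+g)(x⁺) − (f+g)(x) ≤ (1 − δ)·λ·( g(y) − g(x) + ⟪y − x, ∇f(x)⟫ ), then (1 − δ)·‖x⁺ − x‖² ≤ γ·( (f+g)(x) − (f+g)(x⁺) ); in particular (f+g)(x⁺) ≤ (f+g)(x). -/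
open scoped RealInnerProductSpace
open Filter Topology

attribute [local instance] Classical.propDecidable

/-- For a relaxed forward–backward step `x⁺ = x + λ(y − x)` with
`y = prox_{γg}(x − γ∇f(x))` (encoded by `(x − y)/γ − ∇f(x) ∈ ∂g(y)`), the
Armijo-type sufficient decrease condition yields
`(1 − δ)‖x⁺ − x‖² ≤ γ((f+g)(x) − (f+g)(x⁺))`; in particular
`(f+g)(x⁺) ≤ (f+g)(x)`. -/
theorem stmt_13
    {H : Type*} [NormedAddCommGroup H] [InnerProductSpace ℝ H] [CompleteSpace H]
    (domf domg : Set H) (f g : H → ℝ)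
    (hdomf_ne : domf.Nonempty) (hdomf_cvx : Convex ℝ domf)
    (hf_cvx : ConvexOn ℝ domf f)
    (hf_lsc : LowerSemicontinuous fun z : H => if z ∈ domf then (f z : EReal) else ⊤)
    (hdomg_ne : domg.Nonempty) (hdomg_cvx : Convex ℝ domg)
    (hg_cvx : ConvexOn ℝ domg g)
    (hg_lsc : LowerSemicontinuous fun z : H => if z ∈ domg then (g z : EReal) else ⊤)
    (hdom : domg ⊆ domf)
    (f' : H → H)
    (hgat : ∀ z ∈ domg, ∀ d : H,
      Tendsto (fun t : ℝ => (f (z + t • d) - f z) / t) (nhdsWithin 0 {(0 : ℝ)}ᶜ)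
        (nhds ⟪d, f' z⟫))
    (x : H) (hx : x ∈ domg) (γ lam δ : ℝ)
    (hγ : 0 < γ) (hlam0 : 0 < lam) (hlam1 : lam ≤ 1) (hδ0 : 0 < δ) (hδ1 : δ < 1)
    (y : H) (hy : y ∈ domg)
    (hprox : ∀ w ∈ domg, g y + ⟪w - y, γ⁻¹ • (x - y) - f' x⟫ ≤ g w)
    (xp : H) (hxp : xp = x + lam • (y - x))
    (harmijo : (f + g) xp - (f + g) x ≤ (1 - δ) * lam * (g y - g x + ⟪y - x, f' x⟫)) :
    (1 - δ) * ‖xp - x‖ ^ 2 ≤ γ * ((f + g) x - (f + g) xp)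
      ∧ (f + g) xp ≤ (f + g) x := by
  have hinner : ⟪x - y, γ⁻¹ • (x - y) - f' x⟫ = γ⁻¹ * ‖y - x‖ ^ 2 + ⟪y - x, f' x⟫ := by
    rw [inner_sub_right, real_inner_smul_right, real_inner_self_eq_norm_sq, norm_sub_rev x y,
      ← neg_sub y x, inner_neg_left, sub_neg_eq_add]
  have hdescent : g y - g x + ⟪y - x, f' x⟫ ≤ -(γ⁻¹ * ‖y - x‖ ^ 2) := by
    have h := hprox x hx
    rw [hinner] at h
    linarith
  have hstep : ‖xp - x‖ ^ 2 = lam ^ 2 * ‖y - x‖ ^ 2 := by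
    rw [hxp, add_sub_cancel_left, norm_smul, mul_pow, Real.norm_eq_abs, sq_abs]
  have hδ : 0 < 1 - δ := sub_pos.2 hδ1
  have hmain : (1 - δ) * ‖xp - x‖ ^ 2 ≤ γ * ((f + g) x - (f + g) xp) :=
    calc (1 - δ) * ‖xp - x‖ ^ 2 = (1 - δ) * (lam ^ 2 * ‖y - x‖ ^ 2) := by rw [hstep]
      _ ≤ (1 - δ) * (lam * ‖y - x‖ ^ 2) := by
        gcongr
        nlinarith
      _ = γ * ((1 - δ) * lam * (γ⁻¹ * ‖y - x‖ ^ 2)) := by field_simp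
      _ ≤ γ * ((f + g) x - (f + g) xp) := by
        gcongr
        have h := mul_le_mul_of_nonneg_left hdescent (mul_pos hδ hlam0).le
        linarith
  refine ⟨hmain, sub_nonneg.1 (nonneg_of_mul_nonneg_right (le_trans ?_ hmain) hγ)⟩
  positivity
end

section
/- Let H be a real Hilbert space, let (V_k)_{k∈ℕ} be bounded self-adjoint positive operators on H with ν‖x‖² ≤ ⟪x, V_k x⟫ for all k and all x, for some ν > 0. Let h : H → (−∞,+∞] be proper, convex and lower semicontinuous, and let (x_k) be a sequence in dom h such that: (a) (h(x_k)) is decreasing; (b) there exist (α_k) in (0,∞) with sup_k α_k < +∞ and nonnegative summable sequences (η_k), (ε_k) such that for every x ∈ dom h and every k, ⟪x_{k+1} − x, V_{k+1}(x_{k+1} − x)⟫ ≤ (1 + η_k)·⟪x_k − x, V_k(x_k − x)⟫ + 2α_k·( h(x) − h(x_{k+1}) ) + ε_k. If inf_k h(x_k) > −∞, then ∑_{k∈ℕ} ‖x_{k+1} − x_k‖² < +∞. -/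
open scoped RealInnerProductSpace
open Filter Topology

attribute [local instance] Classical.propDecidable

/-- Abstract variable-metric descent principle: summability of
`‖x_{k+1} − x_k‖²`.  The variable metrics are given by bounded self-adjoint
positive operators `V_k` with `ν‖·‖² ≤ ⟪·, V_k ·⟫`; the proper convex lsc
function `h` is modeled by a pair `(domh, h)` of its (nonempty) domain and its
real values there, with lower semicontinuity of the extended function. -/
theorem stmt_14
    {H : Type*} [NormedAddCommGroup H] [InnerProductSpace ℝ H] [CompleteSpace H]
    (V : ℕ → H →L[ℝ] H)
    (hsa : ∀ k : ℕ, ∀ a b : H, ⟪V k a, b⟫ = ⟪a, V k b⟫)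
    (ν : ℝ) (hν : 0 < ν)
    (hlow : ∀ k : ℕ, ∀ a : H, ν * ‖a‖ ^ 2 ≤ ⟪a, V k a⟫)
    (domh : Set H) (h : H → ℝ)
    (hdom_ne : domh.Nonempty) (hdom_cvx : Convex ℝ domh)
    (hcvx : ConvexOn ℝ domh h)
    (hlsc : LowerSemicontinuous fun z : H => if z ∈ domh then (h z : EReal) else ⊤)
    (x : ℕ → H) (hxdom : ∀ k, x k ∈ domh)
    (hdec : ∀ k : ℕ, h (x (k + 1)) ≤ h (x k))
    (α : ℕ → ℝ) (hαpos : ∀ k, 0 < α k) (hαbdd : ∃ M : ℝ, ∀ k, α k ≤ M)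
    (η ε : ℕ → ℝ) (hη0 : ∀ k, 0 ≤ η k) (hε0 : ∀ k, 0 ≤ ε k)
    (hηsum : Summable η) (hεsum : Summable ε)
    (hineq : ∀ z ∈ domh, ∀ k : ℕ,
      ⟪x (k + 1) - z, V (k + 1) (x (k + 1) - z)⟫
        ≤ (1 + η k) * ⟪x k - z, V k (x k - z)⟫
          + 2 * α k * (h z - h (x (k + 1))) + ε k)
    (hbdd : ∃ m : ℝ, ∀ k, m ≤ h (x k)) :
    Summable fun k : ℕ => ‖x (k + 1) - x k‖ ^ 2 := by
  obtain ⟨M, hM⟩ := hαbdd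
  obtain ⟨m, hm⟩ := hbdd
  have hdecrease : Summable fun k : ℕ => h (x k) - h (x (k + 1)) := by
    refine summable_of_sum_range_le (c := h (x 0) - m) (fun k => sub_nonneg.2 (hdec k)) fun n => ?_
    rw [Finset.sum_range_sub' fun k => h (x k)]
    linarith [hm n]
  refine Summable.of_nonneg_of_le (fun k => sq_nonneg _) (fun k => ?_)
    (((hdecrease.mul_left (2 * M)).add hεsum).mul_left ν⁻¹)
  have hstep := hineq (x k) (hxdom k) k
  rw [sub_self, map_zero, inner_zero_left, mul_zero, zero_add] at hstep
  have hα := mul_le_mul_of_nonneg_right (hM k) (sub_nonneg.2 (hdec k))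
  rw [le_inv_mul_iff₀ hν]
  linarith [hlow (k + 1) (x (k + 1) - x k)]
end

section
/- Let H be a real Hilbert space, let (V_k)_{k∈ℕ} be bounded self-adjoint positive operators on H with ν‖x‖² ≤ ⟪x, V_k x⟫ for all k and all x, for some ν > 0, and suppose V_k x → V x (in norm) for every x ∈ H, for some positive operator V. Let h : H → (−∞,+∞] be proper, convex and lower semicontinuous, and let (x_k) be a sequence in dom h satisfying: (a) (h(x_k)) is decreasing; (b) there exist (α_k) in (0,∞) with sup_k α_k < +∞ and nonnegative summable sequences (η_k), (ε_k) such that for every x ∈ dom h and every k, ⟪x_{k+1} − x, V_{k+1}(x_{k+1} − x)⟫ ≤ (1 + η_k)·⟪x_k − x, V_k(x_k − x)⟫ + 2α_k( h(x) − h(x_{k+1}) ) + ε_k; (c) there exist sequences (y_k), (v_k) in H with v_k ∈ ∂h(y_k) for every k, such that for every weakly convergent subsequence (x_{n_k}) of (x_k), x_{n_k} − y_{n_k} ⇀ 0 weakly and ‖v_{n_k}‖ → 0. Then for any x̄ ∈ H and any subsequence (x_{n_k}) with x_{n_k} ⇀ x̄ weakly, x̄ is a minimizer of h over H and h(y_{n_k})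 → inf_H h. -/
open scoped RealInnerProductSpace
open Filter Topology

attribute [local instance] Classical.propDecidable

/-- A weakly convergent sequence in a Hilbert space is bounded. -/
theorem exists_norm_le_of_tendsto_inner
    {H : Type*} [NormedAddCommGroup H] [InnerProductSpace ℝ H] [CompleteSpace H]
    {z : ℕ → H} {a : H}
    (hz : ∀ u : H, Tendsto (fun k => ⟪z k, u⟫) atTop (𝓝 ⟪a, u⟫)) :
    ∃ C : ℝ, ∀ k, ‖z k‖ ≤ C := by
  obtain ⟨C, hC⟩ := banach_steinhaus (g := fun k => innerSL ℝ (z k)) fun u => by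
    obtain ⟨C, hC⟩ := (Metric.isBounded_range_of_tendsto _ (hz u)).exists_norm_le
    exact ⟨C, fun k => hC _ ⟨k, rfl⟩⟩
  exact ⟨C, fun k => by simpa using hC k⟩

/-- If `z k` converges weakly and `v k` converges strongly to zero, then `⟪w - z k, v k⟫ → 0`. -/
theorem tendsto_inner_sub_zero_of_tendsto_inner
    {H : Type*} [NormedAddCommGroup H] [InnerProductSpace ℝ H] [CompleteSpace H]
    {z v : ℕ → H} {a : H}
    (hz : ∀ u : H, Tendsto (fun k => ⟪z k, u⟫) atTop (𝓝 ⟪a, u⟫))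
    (hv : Tendsto (fun k => ‖v k‖) atTop (𝓝 0)) (w : H) :
    Tendsto (fun k => ⟪w - z k, v k⟫) atTop (𝓝 0) := by
  obtain ⟨C, hC⟩ := exists_norm_le_of_tendsto_inner hz
  refine squeeze_zero_norm (a := fun k => (‖w‖ + C) * ‖v k‖) (fun k => ?_)
    (by simpa using hv.const_mul (‖w‖ + C))
  refine (norm_inner_le_norm _ _).trans ?_
  gcongr
  exact (norm_sub_le _ _).trans (by gcongr; exact hC k)

/-- A closed convex subset of a Hilbert space is weakly sequentially closed. -/
theorem IsClosed.mem_of_tendsto_inner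
    {H : Type*} [NormedAddCommGroup H] [InnerProductSpace ℝ H] [CompleteSpace H]
    {C : Set H} (hC : IsClosed C) (hconv : Convex ℝ C) {z : ℕ → H} {a : H}
    (hz : ∀ u : H, Tendsto (fun k => ⟪z k, u⟫) atTop (𝓝 ⟪a, u⟫))
    (hmem : ∀ᶠ k in atTop, z k ∈ C) : a ∈ C := by
  by_contra ha
  obtain ⟨f, u, hfa, hfC⟩ := geometric_hahn_banach_point_closed hconv hC ha
  have hf (b : H) : ⟪b, (InnerProductSpace.toDual ℝ H).symm f⟫ = f b := by
    rw [real_inner_comm, InnerProductSpace.toDual_symm_apply]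
  have hlim := hz ((InnerProductSpace.toDual ℝ H).symm f)
  simp only [hf] at hlim
  exact hfa.not_ge (ge_of_tendsto hlim (hmem.mono fun k hk => (hfC _ hk).le))

/-- Abstract variable-metric descent principle: weak sequential
cluster points are minimizers.  The variable metrics are given by bounded
self-adjoint positive operators `V_k` with `ν‖·‖² ≤ ⟪·, V_k ·⟫` converging
strongly to a positive operator `V`; the proper convex lsc function `h` is
modeled by a pair `(domh, h)`; `v_k ∈ ∂h(y_k)` is the subgradient inclusion. -/
theorem stmt_15
    {H : Type*} [NormedAddCommGroup H] [InnerProductSpace ℝ H] [CompleteSpace H]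
    (V : ℕ → H →L[ℝ] H)
    (hsa : ∀ k : ℕ, ∀ a b : H, ⟪V k a, b⟫ = ⟪a, V k b⟫)
    (ν : ℝ) (hν : 0 < ν)
    (hlow : ∀ k : ℕ, ∀ a : H, ν * ‖a‖ ^ 2 ≤ ⟪a, V k a⟫)
    (Vinf : H →L[ℝ] H)
    (hVinf_sa : ∀ a b : H, ⟪Vinf a, b⟫ = ⟪a, Vinf b⟫)
    (hVinf_pos : ∀ a : H, 0 ≤ ⟪a, Vinf a⟫)
    (hVlim : ∀ a : H, Tendsto (fun k => V k a) atTop (nhds (Vinf a)))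
    (domh : Set H) (h : H → ℝ)
    (hdom_ne : domh.Nonempty) (hdom_cvx : Convex ℝ domh)
    (hcvx : ConvexOn ℝ domh h)
    (hlsc : LowerSemicontinuous fun z : H => if z ∈ domh then (h z : EReal) else ⊤)
    (x : ℕ → H) (hxdom : ∀ k, x k ∈ domh)
    (hdec : ∀ k : ℕ, h (x (k + 1)) ≤ h (x k))
    (α : ℕ → ℝ) (hαpos : ∀ k, 0 < α k) (hαbdd : ∃ M : ℝ, ∀ k, α k ≤ M)
    (η ε : ℕ → ℝ) (hη0 : ∀ k, 0 ≤ η k) (hε0 : ∀ k, 0 ≤ ε k)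
    (hηsum : Summable η) (hεsum : Summable ε)
    (hineq : ∀ z ∈ domh, ∀ k : ℕ,
      ⟪x (k + 1) - z, V (k + 1) (x (k + 1) - z)⟫
        ≤ (1 + η k) * ⟪x k - z, V k (x k - z)⟫
          + 2 * α k * (h z - h (x (k + 1))) + ε k)
    (y v : ℕ → H)
    (hsubgrad : ∀ k : ℕ, y k ∈ domh ∧ ∀ w ∈ domh, h (y k) + ⟪w - y k, v k⟫ ≤ h w)
    (hsubseq : ∀ n : ℕ → ℕ, StrictMono n →
      (∃ z : H, ∀ u : H, Tendsto (fun k => ⟪x (n k), u⟫) atTop (nhds ⟪z, u⟫)) →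
      (∀ u : H, Tendsto (fun k => ⟪x (n k) - y (n k), u⟫) atTop (nhds 0))
        ∧ Tendsto (fun k => ‖v (n k)‖) atTop (nhds 0)) :
    ∀ xbar : H, ∀ n : ℕ → ℕ, StrictMono n →
      (∀ u : H, Tendsto (fun k => ⟪x (n k), u⟫) atTop (nhds ⟪xbar, u⟫)) →
      xbar ∈ domh ∧ (∀ w ∈ domh, h xbar ≤ h w)
        ∧ Tendsto (fun k => h (y (n k))) atTop (nhds (h xbar)) := by
  intro xbar n hn hx
  obtain ⟨hxy, hvn⟩ := hsubseq n hn ⟨xbar, hx⟩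
  have hy (u : H) : Tendsto (fun k => ⟪y (n k), u⟫) atTop (𝓝 ⟪xbar, u⟫) := by
    simpa [inner_sub_left] using (hx u).sub (hxy u)
  have hupper (w : H) (hw : w ∈ domh) (c : ℝ) (hc : h w < c) :
      ∀ᶠ k in atTop, h (y (n k)) < c := by
    filter_upwards [(tendsto_inner_sub_zero_of_tendsto_inner hy hvn w).eventually_const_lt
      (sub_neg.2 hc)] with k hk
    linarith [(hsubgrad (n k)).2 w hw]
  have hclosed (c : ℝ) : IsClosed {z ∈ domh | h z ≤ c} := by
    convert hlsc.isClosed_preimage (c : EReal) using 1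
    ext z
    by_cases hz : z ∈ domh <;> simp [hz]
  have hsublevel (w : H) (hw : w ∈ domh) (c : ℝ) (hc : h w < c) :
      xbar ∈ {z ∈ domh | h z ≤ c} :=
    (hclosed c).mem_of_tendsto_inner (hcvx.convex_le c) hy
      ((hupper w hw c hc).mono fun k hk => ⟨(hsubgrad (n k)).1, hk.le⟩)
  obtain ⟨w₀, hw₀⟩ := hdom_ne
  have hxbar : xbar ∈ domh := (hsublevel w₀ hw₀ _ (lt_add_one _)).1
  have hmin (w : H) (hw : w ∈ domh) : h xbar ≤ h w :=
    le_of_forall_gt_imp_ge_of_dense fun c hc => (hsublevel w hw c hc).2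
  exact ⟨hxbar, hmin, tendsto_order.2
    ⟨fun c hc => .of_forall fun k => hc.trans_le (hmin _ (hsubgrad (n k)).1),
      hupper xbar hxbar⟩⟩
end

section
/- Let H be a real Hilbert space, let (V_k)_{k∈ℕ} be bounded self-adjoint positive operators on H with ν‖x‖² ≤ ⟪x, V_k x⟫ for all k and all x, for some ν > 0, and suppose V_k x → V x (in norm) for every x ∈ H, for some positive operator V. Let h : H → (−∞,+∞] be proper, convex and lower semicontinuous with argmin_H h ≠ ∅, and let (x_k) be a sequence in dom h satisfying conditions (a), (b), (c): (a) (h(x_k)) is decreasing; (b) there exist (α_k) in (0,∞) with sup_k α_k < +∞ and nonnegative summable sequences (η_k), (ε_k) such that for every x ∈ dom h and every k, ⟪x_{k+1} − x, V_{k+1}(x_{k+1} − x)⟫ ≤ (1 + η_k)·⟪x_k − x, V_k(x_k − x)⟫ + 2α_k( h(x) − h(x_{k+1}) ) + ε_k; (c) there exist sequences (y_k), (v_k) in H with v_k ∈ ∂h(y_k) for every k, such that for every weakly convergent subsequence (x_{n_k}) of (x_k), x_{n_k} − y_{n_k} ⇀ 0 weakly and ‖v_{n_k}‖ → 0. Then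 (x_k) and (y_k) converge weakly to one and the same minimizer of h, and h(y_k) → inf_H h. -/
open scoped RealInnerProductSpace
open Filter Topology

attribute [local instance] Classical.propDecidable

/-- A nonnegative sequence satisfying `a (k + 1) ≤ (1 + η k) * a k + ε k` with summable nonnegative
perturbations converges. -/
theorem exists_tendsto_of_quasi_decreasing {a η ε : ℕ → ℝ} (ha : ∀ k, 0 ≤ a k)
    (hη0 : ∀ k, 0 ≤ η k) (hε0 : ∀ k, 0 ≤ ε k) (hη : Summable η) (hε : Summable ε)
    (h : ∀ k, a (k + 1) ≤ (1 + η k) * a k + ε k) : ∃ l, Tendsto a atTop (𝓝 l) := by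
  let P : ℕ → ℝ := fun k => ∏ i ∈ Finset.range k, (1 + η i)
  let S : ℕ → ℝ := fun k => ∑ i ∈ Finset.range k, ε i
  have hP1 : ∀ k, 1 ≤ P k := fun k => Finset.one_le_prod fun i _ => by linarith [hη0 i]
  have hPlim : Tendsto P atTop (𝓝 (∏' i, (1 + η i))) :=
    (Real.multipliable_one_add_of_summable hη).hasProd.tendsto_prod_nat
  have hSlim : Tendsto S atTop (𝓝 (∑' i, ε i)) := hε.hasSum.tendsto_sum_nat
  have hanti : Antitone fun k => a k / P k - S k := by
    refine antitone_nat_of_succ_le fun k => ?_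
    have hPk : 0 < P k := by linarith [hP1 k]
    have hk : 0 < 1 + η k := by linarith [hη0 k]
    have hPs : P (k + 1) = P k * (1 + η k) := Finset.prod_range_succ _ _
    have hSs : S (k + 1) = S k + ε k := Finset.sum_range_succ _ _
    have h1 : a (k + 1) / P (k + 1) ≤ a k / P k + ε k := by
      rw [div_le_iff₀ (by linarith [hP1 (k + 1)])]
      have h2 : (a k / P k + ε k) * P (k + 1) = (1 + η k) * a k + ε k * P (k + 1) := by
        rw [hPs]; field_simp
      rw [h2]
      have := le_mul_of_one_le_right (hε0 k) (hP1 (k + 1))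
      linarith [h k]
    simp only [hSs]
    linarith
  have hbdd : BddBelow (Set.range fun k => a k / P k - S k) := by
    refine ⟨-∑' i, ε i, ?_⟩
    rintro _ ⟨k, rfl⟩
    have h1 : S k ≤ ∑' i, ε i := hε.sum_le_tsum _ fun i _ => hε0 i
    have h2 : 0 ≤ a k / P k := div_nonneg (ha k) (by linarith [hP1 k])
    simp only
    linarith
  have hlim := ((tendsto_atTop_ciInf hanti hbdd).add hSlim).mul hPlim
  refine ⟨_, hlim.congr fun k => ?_⟩
  have hPk : P k ≠ 0 := by linarith [hP1 k]
  field_simp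
  ring

section Hilbert

variable {H : Type*} [NormedAddCommGroup H] [InnerProductSpace ℝ H]

/-- Opial-type uniqueness for variable metrics: two weak cluster points relative to which the
variable-metric distances converge are equal. -/
theorem eq_of_weak_cluster_of_tendsto_metric {V : ℕ → H →L[ℝ] H} {Vinf : H →L[ℝ] H}
    (hsa : ∀ k, ∀ a b : H, ⟪V k a, b⟫ = ⟪a, V k b⟫) {ν : ℝ} (hν : 0 < ν)
    (hlow : ∀ k, ∀ a : H, ν * ‖a‖ ^ 2 ≤ ⟪a, V k a⟫)
    (hVlim : ∀ a : H, Tendsto (fun k => V k a) atTop (𝓝 (Vinf a)))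
    {x : ℕ → H} {C : ℝ} (hC : ∀ k, ‖x k‖ ≤ C) {z₁ z₂ : H} {l₁ l₂ : ℝ}
    (h₁ : Tendsto (fun k => ⟪x k - z₁, V k (x k - z₁)⟫) atTop (𝓝 l₁))
    (h₂ : Tendsto (fun k => ⟪x k - z₂, V k (x k - z₂)⟫) atTop (𝓝 l₂))
    {n₁ n₂ : ℕ → ℕ} (hn₁ : Tendsto n₁ atTop atTop) (hn₂ : Tendsto n₂ atTop atTop)
    (hw₁ : ∀ u : H, Tendsto (fun k => ⟪x (n₁ k), u⟫) atTop (𝓝 ⟪z₁, u⟫))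
    (hw₂ : ∀ u : H, Tendsto (fun k => ⟪x (n₂ k), u⟫) atTop (𝓝 ⟪z₂, u⟫)) : z₁ = z₂ := by
  set d := z₁ - z₂ with hd
  have hq : ∀ z : H, Tendsto (fun k => ⟪z, V k z⟫) atTop (𝓝 ⟪z, Vinf z⟫) := fun z =>
    tendsto_const_nhds.inner (hVlim z)
  have hcross : Tendsto (fun k => ⟪x k, Vinf d - V k d⟫) atTop (𝓝 0) := by
    have h0 : Tendsto (fun k => ‖Vinf d - V k d‖) atTop (𝓝 0) := by
      simpa using ((hVlim d).const_sub (Vinf d)).norm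
    refine squeeze_zero_norm (a := fun k => C * ‖Vinf d - V k d‖) (fun k => ?_)
      (by simpa using h0.const_mul C)
    refine (norm_inner_le_norm _ _).trans ?_
    gcongr
    exact hC k
  obtain ⟨l, hl⟩ : ∃ l, Tendsto (fun k => ⟪x k, Vinf d⟫) atTop (𝓝 l) := by
    refine ⟨_, ((((h₂.sub h₁).add ((hq z₁).sub (hq z₂))).div_const 2).add hcross).congr
      fun k => ?_⟩
    have e₁ : ⟪z₁, V k (x k)⟫ = ⟪x k, V k z₁⟫ := by rw [← hsa, real_inner_comm]
    have e₂ : ⟪z₂, V k (x k)⟫ = ⟪x k, V k z₂⟫ := by rw [← hsa, real_inner_comm]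
    simp only [hd, map_sub, inner_sub_left, inner_sub_right, e₁, e₂]
    ring
  have hzero : ⟪d, Vinf d⟫ = 0 := by
    rw [hd, inner_sub_left, ← hd, tendsto_nhds_unique (hw₁ _) (hl.comp hn₁),
      tendsto_nhds_unique (hw₂ _) (hl.comp hn₂), sub_self]
  have hle : ν * ‖d‖ ^ 2 ≤ 0 := hzero ▸ ge_of_tendsto' (hq d) fun k => hlow k d
  have hd0 : ‖d‖ ^ 2 = 0 := le_antisymm (nonpos_of_mul_nonpos_right hle hν) (sq_nonneg _)
  exact sub_eq_zero.1 (norm_eq_zero.1 (pow_eq_zero_iff two_ne_zero |>.1 hd0))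

variable [CompleteSpace H]

/-- A bounded sequence in a Hilbert space has a weakly convergent subsequence. -/
theorem exists_weak_subseq_of_norm_le {x : ℕ → H} {C : ℝ} (hx : ∀ k, ‖x k‖ ≤ C) :
    ∃ (z : H) (n : ℕ → ℕ), StrictMono n ∧
      ∀ u : H, Tendsto (fun k => ⟪x (n k), u⟫) atTop (𝓝 ⟪z, u⟫) := by
  set K : Submodule ℝ H := (Submodule.span ℝ (Set.range x)).topologicalClosure with hK
  have hxK : ∀ k, x k ∈ K := fun k =>
    Submodule.le_topologicalClosure _ (Submodule.subset_span ⟨k, rfl⟩)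
  have : TopologicalSpace.SeparableSpace K := by
    have h1 : TopologicalSpace.IsSeparable (K : Set H) := by
      rw [hK, Submodule.topologicalClosure_coe]
      exact ((Set.countable_range x).isSeparable.span (R := ℝ)).closure
    exact h1.separableSpace
  have : CompleteSpace K :=
    (Submodule.isClosed_topologicalClosure (Submodule.span ℝ (Set.range x))).completeSpace_coe
  let φ : ℕ → WeakDual ℝ K := fun k =>
    StrongDual.toWeakDual (InnerProductSpace.toDual ℝ K ⟨x k, hxK k⟩)
  obtain ⟨ψ, -, n, hn, hψ⟩ := WeakDual.isSeqCompact_closedBall ℝ K 0 C (x := φ) fun k => by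
    simpa [φ] using hx k
  refine ⟨(InnerProductSpace.toDual ℝ K).symm (WeakDual.toStrongDual ψ), n, hn, fun u => ?_⟩
  have h1 := ((WeakDual.eval_continuous (𝕜 := ℝ) (K.orthogonalProjectionOnto u)).tendsto ψ).comp hψ
  have hin : ∀ w : K, ⟪(w : H), u⟫ = ⟪w, K.orthogonalProjectionOnto u⟫ := fun w => by
    simp
  rw [hin, InnerProductSpace.toDual_symm_apply]
  refine h1.congr fun k => ?_
  have := hin ⟨x (n k), hxK (n k)⟩
  simp only at this
  rw [this]
  simp [φ]

/-- A weakly convergent sequence in a Hilbert space is bounded. -/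
theorem exists_norm_le_of_weak_tendsto {x : ℕ → H} {z : H}
    (hx : ∀ u : H, Tendsto (fun k => ⟪x k, u⟫) atTop (𝓝 ⟪z, u⟫)) : ∃ C, ∀ k, ‖x k‖ ≤ C := by
  obtain ⟨C, hC⟩ := banach_steinhaus (g := fun k => innerSL ℝ (x k)) fun u => by
    obtain ⟨C, hC⟩ := (hx u).norm.bddAbove_range
    exact ⟨C, fun k => hC ⟨k, rfl⟩⟩
  exact ⟨C, fun k => by simpa using hC k⟩

/-- Closed convex sets are weakly sequentially closed. -/
theorem Convex.mem_of_weak_tendsto {C : Set H} (hC : Convex ℝ C) (hcl : IsClosed C)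
    {y : ℕ → H} {z : H} (hy : ∀ u : H, Tendsto (fun k => ⟪y k, u⟫) atTop (𝓝 ⟪z, u⟫))
    (hmem : ∀ᶠ k in atTop, y k ∈ C) : z ∈ C := by
  by_contra hz
  obtain ⟨f, s, hf, hs⟩ := geometric_hahn_banach_closed_point hC hcl hz
  have hrepr : ∀ w, f w = ⟪w, (InnerProductSpace.toDual ℝ H).symm f⟫ := fun w => by
    rw [real_inner_comm, InnerProductSpace.toDual_symm_apply]
  have h1 := hy ((InnerProductSpace.toDual ℝ H).symm f)
  simp only [← hrepr] at h1
  exact absurd (le_of_tendsto h1 (hmem.mono fun k hk => (hf _ hk).le)) (not_le.2 hs)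

/-- Weak limits of points carrying subgradients that tend to zero are minimizers, and the function
values converge to the minimum. -/
theorem isMinOn_of_weak_tendsto_of_subgradient {domh : Set H} {h : H → ℝ}
    (hcvx : ConvexOn ℝ domh h)
    (hlsc : LowerSemicontinuous fun z : H => if z ∈ domh then (h z : EReal) else ⊤)
    {m : H} (hm : m ∈ domh) (hmin : ∀ w ∈ domh, h m ≤ h w) {y v : ℕ → H} {z : H}
    (hsub : ∀ k, y k ∈ domh ∧ ∀ w ∈ domh, h (y k) + ⟪w - y k, v k⟫ ≤ h w)
    (hy : ∀ u : H, Tendsto (fun k => ⟪y k, u⟫) atTop (𝓝 ⟪z, u⟫))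
    (hv : Tendsto (fun k => ‖v k‖) atTop (𝓝 0)) :
    z ∈ domh ∧ (∀ w ∈ domh, h z ≤ h w) ∧ Tendsto (fun k => h (y k)) atTop (𝓝 (h z)) := by
  obtain ⟨C, hC⟩ := exists_norm_le_of_weak_tendsto hy
  have hin : Tendsto (fun k => ⟪m - y k, v k⟫) atTop (𝓝 0) := by
    refine squeeze_zero_norm (a := fun k => (‖m‖ + C) * ‖v k‖) (fun k => ?_)
      (by simpa using hv.const_mul (‖m‖ + C))
    calc ‖⟪m - y k, v k⟫‖ ≤ ‖m - y k‖ * ‖v k‖ := norm_inner_le_norm _ _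
      _ ≤ (‖m‖ + C) * ‖v k‖ := by
        gcongr
        exact (norm_sub_le _ _).trans (by linarith [hC k])
  have hlim : Tendsto (fun k => h (y k)) atTop (𝓝 (h m)) := by
    refine tendsto_of_tendsto_of_tendsto_of_le_of_le tendsto_const_nhds
      (by simpa using hin.const_sub (h m)) (fun k => hmin _ (hsub k).1) fun k => ?_
    have := (hsub k).2 m hm
    simp only
    linarith
  have hlevel : ∀ c, h m < c → z ∈ {w ∈ domh | h w ≤ c} := fun c hc => by
    refine (hcvx.convex_le c).mem_of_weak_tendsto ?_ hy
      ((hlim.eventually_le_const hc).mono fun k hk => ⟨(hsub k).1, hk⟩)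
    convert hlsc.isClosed_preimage (c : EReal) using 1
    ext w
    by_cases hw : w ∈ domh <;> simp [hw]
  have hz : z ∈ domh := (hlevel (h m + 1) (by linarith)).1
  have hzm : h z ≤ h m := le_of_forall_gt_imp_ge_of_dense fun c hc => (hlevel c hc).2
  refine ⟨hz, fun w hw => hzm.trans (hmin w hw), ?_⟩
  rwa [le_antisymm hzm (hmin z hz)]

end Hilbert

/-- Abstract variable-metric descent principle: if `h` has a
minimizer, then `(x_k)` and `(y_k)` converge weakly to one and the same
minimizer of `h`, and `h(y_k) → inf_H h`.  Setup as in Statement 15;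
`argmin h ≠ ∅` is expressed by the existence of a minimizer `m` of `h` over its
domain (`h ≡ +∞` outside `domh`). -/
theorem stmt_16
    {H : Type*} [NormedAddCommGroup H] [InnerProductSpace ℝ H] [CompleteSpace H]
    (V : ℕ → H →L[ℝ] H)
    (hsa : ∀ k : ℕ, ∀ a b : H, ⟪V k a, b⟫ = ⟪a, V k b⟫)
    (ν : ℝ) (hν : 0 < ν)
    (hlow : ∀ k : ℕ, ∀ a : H, ν * ‖a‖ ^ 2 ≤ ⟪a, V k a⟫)
    (Vinf : H →L[ℝ] H)
    (hVinf_sa : ∀ a b : H, ⟪Vinf a, b⟫ = ⟪a, Vinf b⟫)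
    (hVinf_pos : ∀ a : H, 0 ≤ ⟪a, Vinf a⟫)
    (hVlim : ∀ a : H, Tendsto (fun k => V k a) atTop (nhds (Vinf a)))
    (domh : Set H) (h : H → ℝ)
    (hdom_ne : domh.Nonempty) (hdom_cvx : Convex ℝ domh)
    (hcvx : ConvexOn ℝ domh h)
    (hlsc : LowerSemicontinuous fun z : H => if z ∈ domh then (h z : EReal) else ⊤)
    (hargmin : ∃ m ∈ domh, ∀ w ∈ domh, h m ≤ h w)
    (x : ℕ → H) (hxdom : ∀ k, x k ∈ domh)
    (hdec : ∀ k : ℕ, h (x (k + 1)) ≤ h (x k))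
    (α : ℕ → ℝ) (hαpos : ∀ k, 0 < α k) (hαbdd : ∃ M : ℝ, ∀ k, α k ≤ M)
    (η ε : ℕ → ℝ) (hη0 : ∀ k, 0 ≤ η k) (hε0 : ∀ k, 0 ≤ ε k)
    (hηsum : Summable η) (hεsum : Summable ε)
    (hineq : ∀ z ∈ domh, ∀ k : ℕ,
      ⟪x (k + 1) - z, V (k + 1) (x (k + 1) - z)⟫
        ≤ (1 + η k) * ⟪x k - z, V k (x k - z)⟫
          + 2 * α k * (h z - h (x (k + 1))) + ε k)
    (y v : ℕ → H)
    (hsubgrad : ∀ k : ℕ, y k ∈ domh ∧ ∀ w ∈ domh, h (y k) + ⟪w - y k, v k⟫ ≤ h w)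
    (hsubseq : ∀ n : ℕ → ℕ, StrictMono n →
      (∃ z : H, ∀ u : H, Tendsto (fun k => ⟪x (n k), u⟫) atTop (nhds ⟪z, u⟫)) →
      (∀ u : H, Tendsto (fun k => ⟪x (n k) - y (n k), u⟫) atTop (nhds 0))
        ∧ Tendsto (fun k => ‖v (n k)‖) atTop (nhds 0)) :
    ∃ xbar : H, xbar ∈ domh ∧ (∀ w ∈ domh, h xbar ≤ h w)
      ∧ (∀ u : H, Tendsto (fun k => ⟪x k, u⟫) atTop (nhds ⟪xbar, u⟫))
      ∧ (∀ u : H, Tendsto (fun k => ⟪y k, u⟫) atTop (nhds ⟪xbar, u⟫))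
      ∧ Tendsto (fun k => h (y k)) atTop (nhds (h xbar)) := by
  obtain ⟨m, hm, hmin⟩ := hargmin
  have hmetric : ∀ z ∈ domh, (∀ w ∈ domh, h z ≤ h w) →
      ∃ l, Tendsto (fun k => ⟪x k - z, V k (x k - z)⟫) atTop (𝓝 l) := fun z hz hzmin => by
    refine exists_tendsto_of_quasi_decreasing
      (fun k => (mul_nonneg hν.le (sq_nonneg _)).trans (hlow k _)) hη0 hε0 hηsum hεsum fun k => ?_
    have h1 : 2 * α k * (h z - h (x (k + 1))) ≤ 0 :=
      mul_nonpos_of_nonneg_of_nonpos (by linarith [hαpos k])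
        (by linarith [hzmin _ (hxdom (k + 1))])
    linarith [hineq z hz k]
  obtain ⟨C, hC⟩ : ∃ C, ∀ k, ‖x k‖ ≤ C := by
    obtain ⟨l, hl⟩ := hmetric m hm hmin
    obtain ⟨B, hB⟩ := hl.bddAbove_range
    refine ⟨√(B / ν) + ‖m‖, fun k => ?_⟩
    have h1 : ‖x k - m‖ ≤ √(B / ν) := by
      refine Real.le_sqrt_of_sq_le ?_
      rw [le_div_iff₀' hν]
      exact (hlow k _).trans (hB ⟨k, rfl⟩)
    linarith [norm_le_norm_sub_add (x k) m]
  have hcluster : ∀ n : ℕ → ℕ, StrictMono n → ∀ z : H,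
      (∀ u : H, Tendsto (fun k => ⟪x (n k), u⟫) atTop (𝓝 ⟪z, u⟫)) →
      (∀ u : H, Tendsto (fun k => ⟪y (n k), u⟫) atTop (𝓝 ⟪z, u⟫)) ∧ z ∈ domh ∧
        (∀ w ∈ domh, h z ≤ h w) ∧ Tendsto (fun k => h (y (n k))) atTop (𝓝 (h z)) := by
    intro n hn z hz
    obtain ⟨hxy, hv⟩ := hsubseq n hn ⟨z, hz⟩
    have hy : ∀ u : H, Tendsto (fun k => ⟪y (n k), u⟫) atTop (𝓝 ⟪z, u⟫) := fun u => by
      simpa [inner_sub_left] using (hz u).sub (hxy u)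
    exact ⟨hy, isMinOn_of_weak_tendsto_of_subgradient hcvx hlsc hm hmin (fun k => hsubgrad (n k))
      hy hv⟩
  obtain ⟨z, n, hn, hz⟩ := exists_weak_subseq_of_norm_le hC
  obtain ⟨-, hzdom, hzmin, -⟩ := hcluster n hn z hz
  obtain ⟨l, hl⟩ := hmetric z hzdom hzmin
  have hx : ∀ u : H, Tendsto (fun k => ⟪x k, u⟫) atTop (𝓝 ⟪z, u⟫) := fun u => by
    refine tendsto_of_subseq_tendsto fun s hs => ?_
    obtain ⟨p, -, hp⟩ := strictMono_subseq_of_tendsto_atTop hs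
    obtain ⟨z', q, hq, hz'⟩ := exists_weak_subseq_of_norm_le (x := fun k => x (s (p k)))
      fun k => hC _
    have hspq : StrictMono fun k => s (p (q k)) := hp.comp hq
    obtain ⟨-, hdom', hmin', -⟩ := hcluster _ hspq z' hz'
    obtain ⟨l', hl'⟩ := hmetric z' hdom' hmin'
    have hzz : z = z' := eq_of_weak_cluster_of_tendsto_metric hsa hν hlow hVlim hC hl hl'
      hn.tendsto_atTop hspq.tendsto_atTop hz hz'
    exact ⟨fun k => p (q k), hzz ▸ hz' u⟩
  obtain ⟨hy, -, -, hhy⟩ := hcluster id strictMono_id z hx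
  exact ⟨z, hzdom, hzmin, hx, hy, hhy⟩
end

section
/- Let H be a real Hilbert space, let (V_k)_{k∈ℕ} be bounded self-adjoint positive operators on H with ν‖x‖² ≤ ⟪x, V_k x⟫ for all k and all x, for some ν > 0, and suppose V_k x → V x (in norm) for every x ∈ H, for some positive operator V. Let h : H → (−∞,+∞] be proper, convex and lower semicontinuous with argmin_H h ≠ ∅, and let (x_k) be a sequence in dom h satisfying: (a) (h(x_k)) is decreasing; (b) there exist (α_k) in (0,∞) with sup_k α_k < +∞ and nonnegative summable sequences (η_k), (ε_k) such that for every x ∈ dom h and every k, ⟪x_{k+1} − x, V_{k+1}(x_{k+1} − x)⟫ ≤ (1 + η_k)·⟪x_k − x, V_k(x_k − x)⟫ + 2α_k( h(x) − h(x_{k+1}) ) + ε_k. Then: if ∑_k α_k = +∞ then h(x_k) → inf_H h; and if inf_k α_k > 0 then k·( h(x_k) − inf_H h ) → 0, i.e., h(x_k) − inf_H h = o(1/k). -/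
open scoped RealInnerProductSpace
open Filter Topology

attribute [local instance] Classical.propDecidable

/-- A quasi-Fejér type recursion for nonnegative sequences forces its decrements to be summable. -/
theorem summable_of_quasiFejer {a c η ε : ℕ → ℝ} (ha : ∀ k, 0 ≤ a k) (hc : ∀ k, 0 ≤ c k)
    (hη0 : ∀ k, 0 ≤ η k) (hε0 : ∀ k, 0 ≤ ε k) (hη : Summable η) (hε : Summable ε)
    (hrec : ∀ k, a (k + 1) ≤ (1 + η k) * a k - c k + ε k) : Summable c := by
  have key : ∀ n, a n + ∑ k ∈ Finset.range n, c k ≤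
      Real.exp (∑ k ∈ Finset.range n, η k) * (a 0 + ∑ k ∈ Finset.range n, ε k) := by
    intro n
    induction n with
    | zero => simp
    | succ n ih =>
      rw [Finset.sum_range_succ, Finset.sum_range_succ, Finset.sum_range_succ, Real.exp_add]
      have hC : 0 ≤ ∑ k ∈ Finset.range n, c k := Finset.sum_nonneg fun k _ => hc k
      have hS : 0 ≤ ∑ k ∈ Finset.range n, η k := Finset.sum_nonneg fun k _ => hη0 k
      have hE : 1 ≤ Real.exp (∑ k ∈ Finset.range n, η k) * Real.exp (η n) :=
        one_le_mul_of_one_le_of_one_le (Real.one_le_exp hS) (Real.one_le_exp (hη0 n))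
      have hexp : 1 + η n ≤ Real.exp (η n) := by linarith [Real.add_one_le_exp (η n)]
      calc a (n + 1) + (∑ k ∈ Finset.range n, c k + c n)
          ≤ (1 + η n) * (a n + ∑ k ∈ Finset.range n, c k) + ε n := by
            nlinarith [hrec n, mul_nonneg (hη0 n) hC]
        _ ≤ Real.exp (η n) * (Real.exp (∑ k ∈ Finset.range n, η k) *
              (a 0 + ∑ k ∈ Finset.range n, ε k)) +
              (Real.exp (∑ k ∈ Finset.range n, η k) * Real.exp (η n)) * ε n :=
            add_le_add (mul_le_mul hexp ih (add_nonneg (ha n) hC) (Real.exp_pos _).le)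
              (le_mul_of_one_le_left (hε0 n) hE)
        _ = _ := by ring
  refine summable_of_sum_range_le (c := Real.exp (∑' k, η k) * (a 0 + ∑' k, ε k)) hc fun n => ?_
  have hηn := hη.sum_le_tsum (Finset.range n) fun k _ => hη0 k
  have hεn := hε.sum_le_tsum (Finset.range n) fun k _ => hε0 k
  have hE : 0 ≤ ∑ k ∈ Finset.range n, ε k := Finset.sum_nonneg fun k _ => hε0 k
  calc ∑ k ∈ Finset.range n, c k ≤ a n + ∑ k ∈ Finset.range n, c k := by linarith [ha n]
    _ ≤ _ := key n
    _ ≤ _ := mul_le_mul (Real.exp_le_exp.2 hηn) (by linarith) (add_nonneg (ha 0) hE)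
      (Real.exp_pos _).le

/-- Olivier's theorem: the terms of a summable antitone nonnegative sequence are `o(1/n)`. -/
theorem tendsto_nat_mul_zero_of_antitone_of_summable {b : ℕ → ℝ} (hb0 : ∀ k, 0 ≤ b k)
    (hb : Antitone b) (hs : Summable b) :
    Tendsto (fun n : ℕ => (n : ℝ) * b n) atTop (𝓝 0) := by
  have hhalf : Tendsto (fun n : ℕ => n / 2) atTop atTop :=
    Nat.tendsto_div_const_atTop two_ne_zero
  have hlim := hs.hasSum.tendsto_sum_nat
  have hdiff : Tendsto (fun n : ℕ => 2 * (∑ k ∈ Finset.range n, b k -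
      ∑ k ∈ Finset.range (n / 2), b k)) atTop (𝓝 0) := by
    simpa using (hlim.sub (hlim.comp hhalf)).const_mul 2
  refine squeeze_zero (fun n => mul_nonneg n.cast_nonneg (hb0 n)) (fun n => ?_) hdiff
  rw [← Finset.sum_Ico_eq_sub _ (Nat.div_le_self n 2)]
  have hcard := Finset.card_nsmul_le_sum (Finset.Ico (n / 2) n) b (b n)
    fun k hk => hb (Finset.mem_Ico.1 hk).2.le
  rw [Nat.card_Ico, nsmul_eq_mul] at hcard
  have hn : (n : ℝ) ≤ 2 * ((n - n / 2 : ℕ) : ℝ) := by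
    exact_mod_cast (by omega : n ≤ 2 * (n - n / 2))
  nlinarith [mul_le_mul_of_nonneg_right hn (hb0 n)]

/-- Abstract variable-metric descent principle: convergence and
`o(1/k)` rate in function values.  Setup as in Statements 15-16; `argmin h ≠ ∅`
is expressed by a minimizer `m` of `h` over its domain, so that
`inf_H h = h m`.  `∑ α_k = +∞` for the positive sequence `(α_k)` is expressed as
`¬ Summable α`. -/
theorem stmt_17
    {H : Type*} [NormedAddCommGroup H] [InnerProductSpace ℝ H] [CompleteSpace H]
    (V : ℕ → H →L[ℝ] H)
    (hsa : ∀ k : ℕ, ∀ a b : H, ⟪V k a, b⟫ = ⟪a, V k b⟫)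
    (ν : ℝ) (hν : 0 < ν)
    (hlow : ∀ k : ℕ, ∀ a : H, ν * ‖a‖ ^ 2 ≤ ⟪a, V k a⟫)
    (Vinf : H →L[ℝ] H)
    (hVinf_sa : ∀ a b : H, ⟪Vinf a, b⟫ = ⟪a, Vinf b⟫)
    (hVinf_pos : ∀ a : H, 0 ≤ ⟪a, Vinf a⟫)
    (hVlim : ∀ a : H, Tendsto (fun k => V k a) atTop (nhds (Vinf a)))
    (domh : Set H) (h : H → ℝ)
    (hdom_ne : domh.Nonempty) (hdom_cvx : Convex ℝ domh)
    (hcvx : ConvexOn ℝ domh h)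
    (hlsc : LowerSemicontinuous fun z : H => if z ∈ domh then (h z : EReal) else ⊤)
    (m : H) (hm : m ∈ domh) (hmin : ∀ w ∈ domh, h m ≤ h w)
    (x : ℕ → H) (hxdom : ∀ k, x k ∈ domh)
    (hdec : ∀ k : ℕ, h (x (k + 1)) ≤ h (x k))
    (α : ℕ → ℝ) (hαpos : ∀ k, 0 < α k) (hαbdd : ∃ M : ℝ, ∀ k, α k ≤ M)
    (η ε : ℕ → ℝ) (hη0 : ∀ k, 0 ≤ η k) (hε0 : ∀ k, 0 ≤ ε k)
    (hηsum : Summable η) (hεsum : Summable ε)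
    (hineq : ∀ z ∈ domh, ∀ k : ℕ,
      ⟪x (k + 1) - z, V (k + 1) (x (k + 1) - z)⟫
        ≤ (1 + η k) * ⟪x k - z, V k (x k - z)⟫
          + 2 * α k * (h z - h (x (k + 1))) + ε k) :
    (¬ Summable α → Tendsto (fun k => h (x k)) atTop (nhds (h m)))
      ∧ ((∃ a > (0 : ℝ), ∀ k, a ≤ α k) →
          Tendsto (fun k : ℕ => (k : ℝ) * (h (x k) - h m)) atTop (nhds 0)) := by
  set b : ℕ → ℝ := fun k => h (x k) - h m with hb
  have hb0 : ∀ k, 0 ≤ b k := fun k => sub_nonneg.2 (hmin _ (hxdom k))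
  have hanti : Antitone b := antitone_nat_of_succ_le fun k => sub_le_sub_right (hdec k) _
  have hsum : Summable fun k => 2 * α k * b (k + 1) := by
    refine summable_of_quasiFejer (a := fun k => ⟪x k - m, V k (x k - m)⟫)
      (fun k => (by positivity : 0 ≤ ν * ‖x k - m‖ ^ 2).trans (hlow k _))
      (fun k => mul_nonneg (mul_nonneg zero_le_two (hαpos k).le) (hb0 _)) hη0 hε0 hηsum hεsum
      fun k => (hineq m hm k).trans_eq ?_
    simp only [hb]
    ring
  have summable_of_le : ∀ {c : ℝ} {f : ℕ → ℝ}, 0 < c → (∀ k, 0 ≤ f k) →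
      (∀ k, c * f k ≤ 2 * α k * b (k + 1)) → Summable f := fun hc hf hle =>
    (summable_mul_left_iff hc.ne').1
      (hsum.of_nonneg_of_le (fun k => mul_nonneg hc.le (hf k)) hle)
  refine ⟨fun hα => ?_, fun ⟨a, ha, haα⟩ => ?_⟩
  · have hbdd : BddBelow (Set.range b) := ⟨0, Set.forall_mem_range.2 hb0⟩
    have hlim := tendsto_atTop_ciInf hanti hbdd
    rcases (le_ciInf hb0).eq_or_lt with hL | hL
    · rw [← hL] at hlim
      simpa [hb] using hlim.add_const (h m)
    · refine (hα (summable_of_le hL (fun k => (hαpos k).le) fun k => ?_)).elim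
      nlinarith [mul_le_mul_of_nonneg_left (ciInf_le hbdd (k + 1)) (hαpos k).le,
        mul_nonneg (hαpos k).le (hb0 (k + 1))]
  · refine tendsto_nat_mul_zero_of_antitone_of_summable hb0 hanti
      ((summable_nat_add_iff 1).1 (summable_of_le ha (fun k => hb0 (k + 1)) fun k => ?_))
    nlinarith [mul_le_mul_of_nonneg_right (haα k) (hb0 (k + 1)),
      mul_nonneg (hαpos k).le (hb0 (k + 1))]
end

section
/- Let H be a real Hilbert space and let f, g : H → (−∞,+∞] be proper, convex and lower semicontinuous, both bounded from below, with dom g ∩ int(dom f) ≠ ∅. Assume f is Gâteaux differentiable at every point of dom g ∩ int(dom f) with gradient ∇f, and ∇f is bounded on every sublevel set of f+g. Let x₀ ∈ int(dom f) ∩ dom g, set K₀ = { x ∈ H : (f+g)(x) ≤ (f+g)(x₀) }, and assume K₀ ⊂ int(dom f) ∩ dom g and δ₀ := d(K₀, H \ int(dom f)) > 0. Then there exist constants C₁, C₂ ≥ 0 such that for every x ∈ K₀ and every γ > 0, ‖prox_{γg}(x − γ∇f(x)) − x‖ ≤ C₁γ + C₂√γ; consequently, for every x ∈ K₀ and γ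 > 0, if prox_{γg}(x − γ∇f(x)) ∉ dom f then C₁γ + C₂√γ ≥ δ₀. -/
open scoped RealInnerProductSpace
open Filter Topology

attribute [local instance] Classical.propDecidable

/-- The sublevel set `K₀ = { z : (f+g)(z) ≤ (f+g)(x₀) }` of the extended function
`f + g` (which is `+∞` outside `domf ∩ domg`). -/
def sublevelSet {H : Type*} [NormedAddCommGroup H] [InnerProductSpace ℝ H]
    (domf domg : Set H) (f g : H → ℝ) (x₀ : H) : Set H :=
  {z : H | z ∈ domf ∧ z ∈ domg ∧ f z + g z ≤ f x₀ + g x₀}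

/-- A forward-backward step `p` from `x` with stepsize `γ` has length at most
`γ M + √D √γ`, where `M` bounds the forward direction `v` and `D` bounds the decrease of `g`. -/
theorem norm_sub_le_of_subgradient_step {H : Type*} [NormedAddCommGroup H]
    [InnerProductSpace ℝ H] {x p v : H} {γ M D gp gx : ℝ} (hγ : 0 < γ) (hD : 0 ≤ D)
    (hM : ‖v‖ ≤ M) (hg : gx - gp ≤ D)
    (h : gp + ⟪x - p, γ⁻¹ • ((x - γ • v) - p)⟫ ≤ gx) :
    ‖p - x‖ ≤ M * γ + Real.sqrt D * Real.sqrt γ := by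
  have hM0 : 0 ≤ M := (norm_nonneg v).trans hM
  have hexp : ⟪x - p, γ⁻¹ • ((x - γ • v) - p)⟫ = γ⁻¹ * ‖x - p‖ ^ 2 - ⟪x - p, v⟫ := by
    rw [sub_right_comm x, smul_sub, smul_smul, inv_mul_cancel₀ hγ.ne', one_smul,
      inner_sub_right, real_inner_smul_right, real_inner_self_eq_norm_sq]
  have hcs : ⟪x - p, v⟫ ≤ ‖x - p‖ * M :=
    (real_inner_le_norm _ _).trans (mul_le_mul_of_nonneg_left hM (norm_nonneg _))
  have hinv : γ⁻¹ * ‖x - p‖ ^ 2 ≤ D + ‖x - p‖ * M := by linarith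
  have hsq : ‖x - p‖ ^ 2 ≤ γ * (D + ‖x - p‖ * M) := (inv_mul_le_iff₀ hγ).1 hinv
  have hb : (Real.sqrt D * Real.sqrt γ) ^ 2 = D * γ := by
    rw [mul_pow, Real.sq_sqrt hD, Real.sq_sqrt hγ.le]
  have hb0 : 0 ≤ Real.sqrt D * Real.sqrt γ := by positivity
  have ha0 : 0 ≤ M * γ := by positivity
  rw [norm_sub_rev]
  by_contra! hlt
  nlinarith

/-- Uniform bound on the length of a forward–backward step on
the initial sublevel set, and the consequence that steps leaving `dom f` force a
lower bound on the stepsize.  Proper convex lsc functions `f, g` (bounded from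
below) are modeled by pairs `(domf, f)`, `(domg, g)`;
`p = prox_{γg}(x − γ∇f(x))` is encoded by the subgradient inclusion
`((x − γ∇f(x)) − p)/γ ∈ ∂g(p)`; the distance `d(K₀, H \ int dom f)` is
`sInf (image2 dist K₀ (int dom f)ᶜ)`, assumed strictly positive. -/
theorem stmt_19
    {H : Type*} [NormedAddCommGroup H] [InnerProductSpace ℝ H] [CompleteSpace H]
    (domf domg : Set H) (f g : H → ℝ)
    (hdomf_ne : domf.Nonempty) (hdomf_cvx : Convex ℝ domf)
    (hf_cvx : ConvexOn ℝ domf f)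
    (hf_lsc : LowerSemicontinuous fun z : H => if z ∈ domf then (f z : EReal) else ⊤)
    (hf_bdd : ∃ bf : ℝ, ∀ z ∈ domf, bf ≤ f z)
    (hdomg_ne : domg.Nonempty) (hdomg_cvx : Convex ℝ domg)
    (hg_cvx : ConvexOn ℝ domg g)
    (hg_lsc : LowerSemicontinuous fun z : H => if z ∈ domg then (g z : EReal) else ⊤)
    (hg_bdd : ∃ bg : ℝ, ∀ z ∈ domg, bg ≤ g z)
    (hint : (domg ∩ interior domf).Nonempty)
    (f' : H → H)
    (hgat : ∀ z ∈ domg ∩ interior domf, ∀ d : H,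
      Tendsto (fun t : ℝ => (f (z + t • d) - f z) / t) (nhdsWithin 0 {(0 : ℝ)}ᶜ)
        (nhds ⟪d, f' z⟫))
    (hgrad_bdd : ∀ α : ℝ, ∃ M : ℝ, ∀ z : H,
      z ∈ domf → z ∈ domg → f z + g z ≤ α → ‖f' z‖ ≤ M)
    (x₀ : H) (hx₀ : x₀ ∈ interior domf ∩ domg)
    (hK₀ : sublevelSet domf domg f g x₀ ⊆ interior domf ∩ domg)
    (hδ₀ : 0 < sInf (Set.image2 dist (sublevelSet domf domg f g x₀)
      ((interior domf)ᶜ))) :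
    ∃ C₁ C₂ : ℝ, 0 ≤ C₁ ∧ 0 ≤ C₂ ∧
      (∀ x ∈ sublevelSet domf domg f g x₀, ∀ γ : ℝ, 0 < γ → ∀ p : H,
        (p ∈ domg ∧ ∀ w ∈ domg, g p + ⟪w - p, γ⁻¹ • ((x - γ • f' x) - p)⟫ ≤ g w) →
        ‖p - x‖ ≤ C₁ * γ + C₂ * Real.sqrt γ)
      ∧ (∀ x ∈ sublevelSet domf domg f g x₀, ∀ γ : ℝ, 0 < γ → ∀ p : H,
          (p ∈ domg ∧ ∀ w ∈ domg, g p + ⟪w - p, γ⁻¹ • ((x - γ • f' x) - p)⟫ ≤ g w) →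
          p ∉ domf →
          sInf (Set.image2 dist (sublevelSet domf domg f g x₀) ((interior domf)ᶜ))
            ≤ C₁ * γ + C₂ * Real.sqrt γ) := by
  obtain ⟨bf, hbf⟩ := hf_bdd
  obtain ⟨bg, hbg⟩ := hg_bdd
  obtain ⟨M, hM⟩ := hgrad_bdd (f x₀ + g x₀)
  have hx₀f : x₀ ∈ domf := interior_subset hx₀.1
  have hM0 : 0 ≤ M := (norm_nonneg _).trans (hM x₀ hx₀f hx₀.2 le_rfl)
  have hD : 0 ≤ f x₀ + g x₀ - bf - bg := by linarith [hbf x₀ hx₀f, hbg x₀ hx₀.2]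
  have key : ∀ x ∈ sublevelSet domf domg f g x₀, ∀ γ : ℝ, 0 < γ → ∀ p : H,
      (p ∈ domg ∧ ∀ w ∈ domg, g p + ⟪w - p, γ⁻¹ • ((x - γ • f' x) - p)⟫ ≤ g w) →
      ‖p - x‖ ≤ M * γ + Real.sqrt (f x₀ + g x₀ - bf - bg) * Real.sqrt γ := by
    rintro x ⟨hxf, hxg, hx⟩ γ hγ p ⟨hp, hsub⟩
    exact norm_sub_le_of_subgradient_step hγ hD (hM x hxf hxg hx)
      (by linarith [hbf x hxf, hbg p hp]) (hsub x hxg)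
  refine ⟨M, _, hM0, Real.sqrt_nonneg _, key, fun x hx γ hγ p hp hpf => ?_⟩
  refine le_trans ?_ (key x hx γ hγ p hp)
  rw [← dist_eq_norm, dist_comm]
  refine csInf_le ⟨0, ?_⟩ (Set.mem_image2_of_mem hx fun h => hpf (interior_subset h))
  rintro _ ⟨a, -, b, -, rfl⟩
  exact dist_nonneg
end
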